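/- arXiv:math/0511514 — 3 statements merged into one kernel-verified Lean document; each statement's English description precedes it below -/
import Mathlib

section
/- Let F be a complete Noetherian local Λ-algebra, 𝓕 = Hom_Λ(F,−), and Γ ⊆ Aut_Λ(F). If the quotient 𝓕/Γ is pro-representable, then Γ acts trivially on the tangent space TF, the quotient map 𝓕 → 𝓕/Γ is an isomorphism, and Γ acts trivially on each 𝓕(A), i.e. 𝓕/Γ ≅ 𝓕. -/
open IsLocalRing

universe u v

/-- An object of the category `Art` of Artinian local `Λ`-algebras with residue field
`k = Λ/m_Λ` (the augmentation is encoded by `resSurj`: every element is congruent to a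
constant modulo the maximal ideal, so that `A/m_A ≅ k` canonically). -/
structure ArtAlg (Λ : Type u) [CommRing Λ] [IsLocalRing Λ] : Type (u + 1) where
  carrier : Type u
  [cring : CommRing carrier]
  [alg : Algebra Λ carrier]
  [art : IsArtinianRing carrier]
  [loc : IsLocalRing carrier]
  [locHom : IsLocalHom (algebraMap Λ carrier)]
  resSurj : ∀ a : carrier, ∃ c : Λ, a - algebraMap Λ carrier c ∈ maximalIdeal carrier

attribute [instance] ArtAlg.cring ArtAlg.alg ArtAlg.art ArtAlg.loc ArtAlg.locHom

variable {Λ : Type u} [CommRing Λ] [IsLocalRing Λ]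

/-- Morphisms in `Art`: local `Λ`-algebra homomorphisms (compatibility with the
augmentations is then automatic). -/
structure ArtHom (A B : ArtAlg Λ) where
  toAlgHom : A.carrier →ₐ[Λ] B.carrier
  isLocal : IsLocalHom toAlgHom.toRingHom

def ArtHom.id (A : ArtAlg Λ) : ArtHom A A :=
  ⟨AlgHom.id Λ A.carrier, ⟨fun _ h => h⟩⟩

def ArtHom.comp {A B C : ArtAlg Λ} (g : ArtHom B C) (f : ArtHom A B) : ArtHom A C :=
  ⟨g.toAlgHom.comp f.toAlgHom, ⟨fun a h => f.isLocal.1 a (g.isLocal.1 (f.toAlgHom a) h)⟩⟩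

/-- A covariant functor `Art → Sets`. -/
structure ArtFunctor (Λ : Type u) [CommRing Λ] [IsLocalRing Λ] : Type (u + 1) where
  obj : ArtAlg Λ → Type u
  map : {A B : ArtAlg Λ} → ArtHom A B → obj A → obj B
  map_id : ∀ (A : ArtAlg Λ) (x : obj A), map (ArtHom.id A) x = x
  map_comp : ∀ {A B C : ArtAlg Λ} (f : ArtHom A B) (g : ArtHom B C) (x : obj A),
    map (g.comp f) x = map g (map f x)

/-- A natural transformation between functors `Art → Sets`. -/
structure ArtNatTrans (F G : ArtFunctor Λ) where
  app : ∀ A : ArtAlg Λ, F.obj A → G.obj A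
  naturality : ∀ {A B : ArtAlg Λ} (f : ArtHom A B) (x : F.obj A),
    app B (F.map f x) = G.map f (app A x)

/-- A complete Noetherian local `Λ`-algebra with residue field `k`,
a pro-representing object. -/
structure ProRepAlg (Λ : Type u) [CommRing Λ] [IsLocalRing Λ] : Type (u + 1) where
  carrier : Type u
  [cring : CommRing carrier]
  [alg : Algebra Λ carrier]
  [noeth : IsNoetherianRing carrier]
  [loc : IsLocalRing carrier]
  [locHom : IsLocalHom (algebraMap Λ carrier)]
  [complete : IsAdicComplete (maximalIdeal carrier) carrier]
  resSurj : ∀ a : carrier, ∃ c : Λ, a - algebraMap Λ carrier c ∈ maximalIdeal carrier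

attribute [instance] ProRepAlg.cring ProRepAlg.alg ProRepAlg.noeth ProRepAlg.loc
  ProRepAlg.locHom ProRepAlg.complete

/-- Local `Λ`-algebra homomorphisms `R → S`. -/
def LocHom (Λ : Type u) [CommRing Λ] (R S : Type u) [CommRing R] [CommRing S]
    [Algebra Λ R] [Algebra Λ S] [IsLocalRing R] [IsLocalRing S] : Type u :=
  {f : R →ₐ[Λ] S // IsLocalHom f.toRingHom}

/-- The pro-representable functor `h_F = Hom_Λ(F, -)`. -/
def hFunctor (F : ProRepAlg Λ) : ArtFunctor Λ where
  obj A := LocHom Λ F.carrier A.carrier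
  map {A B} f x := ⟨f.toAlgHom.comp x.1, ⟨fun a h => x.2.1 a (f.isLocal.1 (x.1 a) h)⟩⟩
  map_id A x := Subtype.ext (AlgHom.ext fun _ => rfl)
  map_comp f g x := Subtype.ext (AlgHom.ext fun _ => rfl)

/-- An algebra automorphism of `F`, as a ring hom, is a local homomorphism. -/
theorem AlgEquiv.isLocalHom_toRingHom {F : ProRepAlg Λ} (g : F.carrier ≃ₐ[Λ] F.carrier) :
    IsLocalHom ((g : F.carrier →ₐ[Λ] F.carrier).toRingHom) :=
  ⟨fun a h => by simpa using h.map g.symm.toAlgHom.toRingHom⟩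

/-- Precomposition of an element of `h_F(A) = Hom_Λ(F, A)` with a local endomorphism
`g : F → F`; this is the value on `A` of the natural transformation `h_F → h_F`
induced by `g`. -/
def precompEnd {F : ProRepAlg Λ} {A : ArtAlg Λ} (g : LocHom Λ F.carrier F.carrier)
    (z : (hFunctor F).obj A) : (hFunctor F).obj A :=
  ⟨z.1.comp g.1, ⟨fun a h => g.2.1 a (z.2.1 (g.1 a) h)⟩⟩

/-- Precomposition action of `Aut_Λ(F)` on `h_F(A) = Hom_Λ(F, A)`. -/
def precompAut {F : ProRepAlg Λ} {A : ArtAlg Λ} (g : F.carrier ≃ₐ[Λ] F.carrier)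
    (x : (hFunctor F).obj A) : (hFunctor F).obj A :=
  ⟨x.1.comp g.toAlgHom, ⟨fun a h => (AlgEquiv.isLocalHom_toRingHom g).1 a (x.2.1 _ h)⟩⟩

/-- The orbit equivalence relation of `Γ ⊆ Aut_Λ(F)` on `h_F(A)`. -/
def orbitSetoid (F : ProRepAlg Λ) (Γ : Subgroup (F.carrier ≃ₐ[Λ] F.carrier))
    (A : ArtAlg Λ) : Setoid ((hFunctor F).obj A) where
  r x y := ∃ g ∈ Γ, precompAut g x = y
  iseqv := by
    constructor
    · exact fun x => ⟨1, Γ.one_mem, Subtype.ext (AlgHom.ext fun a => rfl)⟩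
    · rintro x y ⟨g, hg, rfl⟩
      exact ⟨g⁻¹, Γ.inv_mem hg, Subtype.ext (AlgHom.ext fun a =>
        show x.1 (g (g.symm a)) = x.1 a by rw [g.apply_symm_apply])⟩
    · rintro x y z ⟨g, hg, rfl⟩ ⟨h, hh, rfl⟩
      exact ⟨g * h, Γ.mul_mem hg hh, Subtype.ext (AlgHom.ext fun a => rfl)⟩

/-- The quotient functor `𝓕/Γ`. -/
def quotFunctor (F : ProRepAlg Λ) (Γ : Subgroup (F.carrier ≃ₐ[Λ] F.carrier)) :
    ArtFunctor Λ where
  obj A := Quotient (orbitSetoid F Γ A)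
  map {A B} f := Quotient.map ((hFunctor F).map f) (by
    rintro x y ⟨g, hg, rfl⟩
    exact ⟨g, hg, Subtype.ext (AlgHom.ext fun a => rfl)⟩)
  map_id A := by
    rintro ⟨x⟩
    exact congrArg (Quotient.mk _) ((hFunctor F).map_id A x)
  map_comp f g := by
    rintro ⟨x⟩
    exact congrArg (Quotient.mk _) ((hFunctor F).map_comp f g x)

/-- The quotient map `q : 𝓕 → 𝓕/Γ`. -/
def quotMap (F : ProRepAlg Λ) (Γ : Subgroup (F.carrier ≃ₐ[Λ] F.carrier)) :
    ArtNatTrans (hFunctor F) (quotFunctor F Γ) where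
  app A := Quotient.mk _
  naturality f x := rfl

/-- Formal smoothness of a natural transformation `q : 𝓕 → 𝓓`: for every surjection
`π : A ↠ B` in `Art`, the induced map `𝓕(A) → 𝓕(B) ×_{𝓓(B)} 𝓓(A)` is surjective. -/
def FormallySmooth' {𝓕 𝓓 : ArtFunctor Λ} (q : ArtNatTrans 𝓕 𝓓) : Prop :=
  ∀ {A B : ArtAlg Λ} (π : ArtHom A B), Function.Surjective π.toAlgHom →
    ∀ (b : 𝓕.obj B) (d : 𝓓.obj A), q.app B b = 𝓓.map π d →
      ∃ a : 𝓕.obj A, 𝓕.map π a = b ∧ q.app A a = d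

/-- `A` is of the form `k[V]` for a `k`-vector space `V`: the maximal ideal is
square-zero and `m_Λ A = 0`. -/
def IsKV (A : ArtAlg Λ) : Prop :=
  maximalIdeal A.carrier ^ 2 = ⊥ ∧
    Ideal.map (algebraMap Λ A.carrier) (maximalIdeal Λ) = ⊥

/-- `A` is (isomorphic to) `k[ε] = k[t]/t²`: it is a `k[V]` with one-dimensional
maximal ideal. -/
def IsDualNumbers (A : ArtAlg Λ) : Prop :=
  IsKV A ∧ ∃ t : A.carrier, t ≠ 0 ∧ maximalIdeal A.carrier = Ideal.span {t}

/-- `𝓓` has a hull: a formally smooth natural transformation `h_F → 𝓓` which is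
bijective on all rings `k[V]`. -/
def HasHull (𝓓 : ArtFunctor Λ) : Prop :=
  ∃ (F : ProRepAlg Λ) (α : ArtNatTrans (hFunctor F) 𝓓), FormallySmooth' α ∧
    ∀ A : ArtAlg Λ, IsKV A → Function.Bijective (α.app A)

/-- `(R, p, q)` is the fibre product `A ×_B C` of `f : A → B` and `g : C → B`. -/
def IsFibreProduct {A B C R : ArtAlg Λ} (f : ArtHom A B) (g : ArtHom C B)
    (p : ArtHom R A) (q : ArtHom R C) : Prop :=
  (∀ r : R.carrier, f.toAlgHom (p.toAlgHom r) = g.toAlgHom (q.toAlgHom r)) ∧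
    ∀ (a : A.carrier) (c : C.carrier), f.toAlgHom a = g.toAlgHom c →
      ∃! r : R.carrier, p.toAlgHom r = a ∧ q.toAlgHom r = c

/-- `g` acts trivially on the tangent space `TF = Hom_k(m_F/(m_F² + m_Λ F), k)`,
i.e. it is the identity on the cotangent space `m_F/(m_F² + m_Λ F)`. -/
def ActsTriviallyOnTangent (F : ProRepAlg Λ) (g : F.carrier ≃ₐ[Λ] F.carrier) : Prop :=
  ∀ x ∈ maximalIdeal F.carrier,
    g x - x ∈ maximalIdeal F.carrier ^ 2 ⊔
      Ideal.map (algebraMap Λ F.carrier) (maximalIdeal Λ)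


/-- The fibre product `A ×_k A`, as an `A`-subalgebra of `A × A`. -/
def doubleSub (A : ArtAlg Λ) : Subalgebra A.carrier (A.carrier × A.carrier) where
  carrier := {p | p.1 - p.2 ∈ maximalIdeal A.carrier}
  mul_mem' := by
    rintro ⟨a, b⟩ ⟨c, d⟩ h1 h2
    have h1' : a - b ∈ maximalIdeal A.carrier := h1
    have h2' : c - d ∈ maximalIdeal A.carrier := h2
    change a * c - b * d ∈ maximalIdeal A.carrier
    have : a * c - b * d = c * (a - b) + b * (c - d) := by ring
    rw [this]
    exact Ideal.add_mem _ (Ideal.mul_mem_left _ _ h1') (Ideal.mul_mem_left _ _ h2')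
  add_mem' := by
    rintro ⟨a, b⟩ ⟨c, d⟩ h1 h2
    have h1' : a - b ∈ maximalIdeal A.carrier := h1
    have h2' : c - d ∈ maximalIdeal A.carrier := h2
    change a + c - (b + d) ∈ maximalIdeal A.carrier
    have : a + c - (b + d) = (a - b) + (c - d) := by ring
    rw [this]
    exact Ideal.add_mem _ h1' h2'
  algebraMap_mem' := by
    intro a
    change a - a ∈ maximalIdeal A.carrier
    simp

theorem isUnit_of_sub_mem (A : ArtAlg Λ) {a b : A.carrier}
    (h : a - b ∈ maximalIdeal A.carrier) (ha : IsUnit a) : IsUnit b := by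
  by_contra hb
  have hb' : b ∈ maximalIdeal A.carrier := (mem_maximalIdeal b).2 hb
  have : a ∈ maximalIdeal A.carrier := by simpa using Ideal.add_mem _ h hb'
  exact (mem_maximalIdeal a).1 this ha

def doubleFst (A : ArtAlg Λ) : doubleSub A →ₐ[Λ] A.carrier :=
  (AlgHom.fst Λ A.carrier A.carrier).comp ((doubleSub A).val.restrictScalars Λ)

def doubleSnd (A : ArtAlg Λ) : doubleSub A →ₐ[Λ] A.carrier :=
  (AlgHom.snd Λ A.carrier A.carrier).comp ((doubleSub A).val.restrictScalars Λ)

theorem doubleSub_isUnit (A : ArtAlg Λ) (p : doubleSub A) (h1 : IsUnit p.1.1)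
    (h2 : IsUnit p.1.2) : IsUnit p := by
  obtain ⟨⟨a, b⟩, hp⟩ := p
  have hp' : a - b ∈ maximalIdeal A.carrier := hp
  obtain ⟨a', ha⟩ := h1.exists_right_inv
  obtain ⟨b', hb⟩ := h2.exists_right_inv
  change a * a' = 1 at ha
  change b * b' = 1 at hb
  have hmem : (a', b') ∈ doubleSub A := by
    change a' - b' ∈ maximalIdeal A.carrier
    have : a' - b' = -(a' * b') * (a - b) := by linear_combination (-a') * hb + b' * ha
    rw [this]
    exact Ideal.mul_mem_left _ _ hp'
  refine IsUnit.of_mul_eq_one ⟨(a', b'), hmem⟩ ?_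
  exact Subtype.ext (Prod.ext ha hb)

theorem doubleFst_isLocal (A : ArtAlg Λ) : IsLocalHom (doubleFst A).toRingHom :=
  ⟨fun p h => doubleSub_isUnit A p h (isUnit_of_sub_mem A p.2 h)⟩

theorem doubleSnd_isLocal (A : ArtAlg Λ) : IsLocalHom (doubleSnd A).toRingHom :=
  ⟨fun p h => doubleSub_isUnit A p
    (isUnit_of_sub_mem A (b := p.1.1) (a := p.1.2)
      (by
        have h0 : p.1.1 - p.1.2 ∈ maximalIdeal A.carrier := p.2
        rw [← neg_sub]
        exact neg_mem h0) h) h⟩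

/-- `A ×_k A` as an object of `Art`. -/
def doubleAlg (A : ArtAlg Λ) : ArtAlg Λ :=
  haveI := doubleFst_isLocal A
  haveI hl : IsLocalRing (doubleSub A) := (doubleFst A).toRingHom.domain_isLocalRing
  haveI : IsArtinian A.carrier (doubleSub A) :=
    inferInstanceAs (IsArtinian A.carrier (Subalgebra.toSubmodule (doubleSub A)))
  { carrier := doubleSub A
    art := isArtinian_of_tower A.carrier inferInstance
    loc := hl
    locHom := ⟨fun c hc => A.locHom.1 c (by
      have := hc.map (doubleFst A)
      rwa [AlgHom.commutes] at this)⟩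
    resSurj := fun p => by
      obtain ⟨c, hc⟩ := A.resSurj p.1.1
      refine ⟨c, ?_⟩
      rw [mem_maximalIdeal] at hc ⊢
      intro h
      apply hc
      have := h.map (doubleFst A)
      rw [map_sub, AlgHom.commutes] at this
      exact this }

def doubleP (A : ArtAlg Λ) : ArtHom (doubleAlg A) A := ⟨doubleFst A, doubleFst_isLocal A⟩

def doubleQ (A : ArtAlg Λ) : ArtHom (doubleAlg A) A := ⟨doubleSnd A, doubleSnd_isLocal A⟩

theorem hom_sub_mem {F : ProRepAlg Λ} {A : ArtAlg Λ} (x y : (hFunctor F).obj A)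
    (f : F.carrier) : x.1 f - y.1 f ∈ maximalIdeal A.carrier := by
  obtain ⟨c, hc⟩ := F.resSurj f
  have key : ∀ z : (hFunctor F).obj A,
      z.1 (f - algebraMap Λ F.carrier c) ∈ maximalIdeal A.carrier := by
    intro z
    rw [mem_maximalIdeal] at hc ⊢
    exact fun h => hc (z.2.1 _ h)
  have := Ideal.sub_mem _ (key x) (key y)
  rw [map_sub, map_sub, AlgHom.commutes, AlgHom.commutes] at this
  simpa using this

/-- The pairing `h_F(A) × h_F(A) → h_F(A ×_k A)`. -/
def pairHom {F : ProRepAlg Λ} {A : ArtAlg Λ} (x y : (hFunctor F).obj A) :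
    (hFunctor F).obj (doubleAlg A) :=
  ⟨{ toFun := fun f => ⟨(x.1 f, y.1 f), hom_sub_mem x y f⟩
     map_one' := Subtype.ext (Prod.ext (map_one x.1) (map_one y.1))
     map_mul' := fun a b => Subtype.ext (Prod.ext (map_mul x.1 a b) (map_mul y.1 a b))
     map_zero' := Subtype.ext (Prod.ext (map_zero x.1) (map_zero y.1))
     map_add' := fun a b => Subtype.ext (Prod.ext (map_add x.1 a b) (map_add y.1 a b))
     commutes' := fun c => Subtype.ext (Prod.ext (x.1.commutes c) (y.1.commutes c)) },
   ⟨fun f h => x.2.1 f (h.map (doubleFst A))⟩⟩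

theorem double_ext {F : ProRepAlg Λ} {A : ArtAlg Λ} (u v : (hFunctor F).obj (doubleAlg A))
    (h1 : (hFunctor F).map (doubleP A) u = (hFunctor F).map (doubleP A) v)
    (h2 : (hFunctor F).map (doubleQ A) u = (hFunctor F).map (doubleQ A) v) : u = v := by
  refine Subtype.ext (AlgHom.ext fun f => Subtype.ext (Prod.ext ?_ ?_))
  · exact DFunLike.congr_fun (congrArg Subtype.val h1) f
  · exact DFunLike.congr_fun (congrArg Subtype.val h2) f

theorem quot_double_ext {F : ProRepAlg Λ} {Γ : Subgroup (F.carrier ≃ₐ[Λ] F.carrier)}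
    {G : ProRepAlg Λ} (η : ArtNatTrans (hFunctor G) (quotFunctor F Γ))
    (hη : ∀ A : ArtAlg Λ, Function.Bijective (η.app A)) {A : ArtAlg Λ}
    (d e : (quotFunctor F Γ).obj (doubleAlg A))
    (h1 : (quotFunctor F Γ).map (doubleP A) d = (quotFunctor F Γ).map (doubleP A) e)
    (h2 : (quotFunctor F Γ).map (doubleQ A) d = (quotFunctor F Γ).map (doubleQ A) e) :
    d = e := by
  obtain ⟨u, rfl⟩ := (hη _).2 d
  obtain ⟨v, rfl⟩ := (hη _).2 e
  rw [← η.naturality, ← η.naturality] at h1 h2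
  rw [double_ext u v ((hη _).1 h1) ((hη _).1 h2)]

theorem action_trivial {F : ProRepAlg Λ} {Γ : Subgroup (F.carrier ≃ₐ[Λ] F.carrier)}
    {G : ProRepAlg Λ} (η : ArtNatTrans (hFunctor G) (quotFunctor F Γ))
    (hη : ∀ A : ArtAlg Λ, Function.Bijective (η.app A)) (A : ArtAlg Λ)
    (x : (hFunctor F).obj A) (g : F.carrier ≃ₐ[Λ] F.carrier) (hg : g ∈ Γ) :
    precompAut g x = x := by
  have hq : (quotMap F Γ).app _ (pairHom x x) = (quotMap F Γ).app _ (pairHom x (precompAut g x)) := by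
    apply quot_double_ext η hη
    · rw [← (quotMap F Γ).naturality, ← (quotMap F Γ).naturality]
      rfl
    · rw [← (quotMap F Γ).naturality, ← (quotMap F Γ).naturality]
      exact Quotient.sound (s := orbitSetoid F Γ A) ⟨g, hg, rfl⟩
  obtain ⟨γ, -, hγ⟩ := Quotient.exact (s := orbitSetoid F Γ (doubleAlg A)) hq
  have h1 := congrArg ((hFunctor F).map (doubleP A)) hγ
  have h2 := congrArg ((hFunctor F).map (doubleQ A)) hγ
  have h1' : precompAut γ x = x := h1
  have h2' : precompAut γ x = precompAut g x := h2
  rw [← h2', h1']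

/-- The ideal `m_F² + m_Λ F`. -/
def cotIdeal (F : ProRepAlg Λ) : Ideal F.carrier :=
  maximalIdeal F.carrier ^ 2 ⊔ Ideal.map (algebraMap Λ F.carrier) (maximalIdeal Λ)

theorem cotIdeal_le (F : ProRepAlg Λ) : cotIdeal F ≤ maximalIdeal F.carrier := by
  refine sup_le (Ideal.pow_le_self two_ne_zero) ?_
  rw [Ideal.map_le_iff_le_comap]
  intro c hc
  rw [Ideal.mem_comap, mem_maximalIdeal]
  rw [mem_maximalIdeal] at hc
  exact fun h => hc (F.locHom.1 c h)

/-- `F / (m_F² + m_Λ F)` as an object of `Art`. -/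
def cotAlg (F : ProRepAlg Λ) : ArtAlg Λ :=
  haveI hnt : Nontrivial (F.carrier ⧸ cotIdeal F) := Ideal.Quotient.nontrivial_iff.2
    (fun h => Ideal.IsPrime.ne_top' (I := maximalIdeal F.carrier)
      (top_le_iff.1 (h ▸ cotIdeal_le F)))
  haveI hl : IsLocalRing (F.carrier ⧸ cotIdeal F) :=
    IsLocalRing.of_surjective' (Ideal.Quotient.mk (cotIdeal F)) Ideal.Quotient.mk_surjective
  haveI hlh : IsLocalHom (Ideal.Quotient.mk (cotIdeal F)) :=
    IsLocalHom.of_surjective _ Ideal.Quotient.mk_surjective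
  { carrier := F.carrier ⧸ cotIdeal F
    art := by
      rw [isArtinianRing_iff_isNilpotent_maximalIdeal]
      refine ⟨2, ?_⟩
      rw [← map_maximalIdeal_of_surjective (Ideal.Quotient.mk (cotIdeal F))
        Ideal.Quotient.mk_surjective, ← Ideal.map_pow]
      exact le_bot_iff.1
        (le_trans (Ideal.map_mono le_sup_left) (Ideal.map_quotient_self (cotIdeal F)).le)
    loc := hl
    locHom := ⟨fun c hc => F.locHom.1 c (hlh.1 _ hc)⟩
    resSurj := fun a => by
      obtain ⟨f, rfl⟩ := Ideal.Quotient.mk_surjective a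
      obtain ⟨c, hc⟩ := F.resSurj f
      refine ⟨c, ?_⟩
      rw [mem_maximalIdeal] at hc ⊢
      exact fun h => hc (hlh.1 _ h) }

def cotProj (F : ProRepAlg Λ) : (hFunctor F).obj (cotAlg F) :=
  ⟨Ideal.Quotient.mkₐ Λ (cotIdeal F),
    haveI := (cotAlg F).loc.toNontrivial
    haveI : Nontrivial (F.carrier ⧸ cotIdeal F) := this
    IsLocalHom.of_surjective (Ideal.Quotient.mk (cotIdeal F)) Ideal.Quotient.mk_surjective⟩

/-- If `𝓕/Γ` is pro-representable then `Γ` acts trivially on the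
tangent space, the quotient map `𝓕 → 𝓕/Γ` is an isomorphism, and `Γ` acts trivially
on each `𝓕(A)`. -/
theorem trivial_action_of_proRepresentable_quotient {Λ : Type u} [CommRing Λ] [IsLocalRing Λ] [IsNoetherianRing Λ]
    [IsAdicComplete (maximalIdeal Λ) Λ]
    (F : ProRepAlg Λ) (Γ : Subgroup (F.carrier ≃ₐ[Λ] F.carrier))
    (hrep : ∃ (G : ProRepAlg Λ) (η : ArtNatTrans (hFunctor G) (quotFunctor F Γ)),
      ∀ A : ArtAlg Λ, Function.Bijective (η.app A)) :
    (∀ g ∈ Γ, ActsTriviallyOnTangent F g) ∧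
      (∀ A : ArtAlg Λ, Function.Bijective ((quotMap F Γ).app A)) ∧
      (∀ (A : ArtAlg Λ) (x : (hFunctor F).obj A), ∀ g ∈ Γ, precompAut g x = x) := by
  obtain ⟨G, η, hη⟩ := hrep
  have key := fun (A : ArtAlg Λ) (x : (hFunctor F).obj A) g hg =>
    action_trivial η hη A x g hg
  refine ⟨fun g hg x _ => ?_, fun A => ⟨fun x y h => ?_, Quotient.mk_surjective⟩, key⟩
  · have h := DFunLike.congr_fun (congrArg Subtype.val (key (cotAlg F) (cotProj F) g hg)) x
    exact (Ideal.Quotient.mk_eq_mk_iff_sub_mem (I := cotIdeal F) (g x) x).1 h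
  · obtain ⟨g, hg, rfl⟩ := Quotient.exact (s := orbitSetoid F Γ A) h
    exact (key A x g hg).symm
end

section
/- Let q : 𝓕 → 𝓓 be a hull, with 𝓕 = Hom_Λ(F,−) pro-representable, and suppose that for all A → B ← C in Art the map 𝓓(A ×_B C) → 𝓓(A) ×_{𝓓(B)} 𝓓(C) is surjective. Let Γ ⊆ Aut_Λ(F) be the subgroup of automorphisms g with q ∘ g = q as natural transformations. Then Γ acts trivially on the tangent space TF, and the induced map 𝓕(A)/Γ → 𝓓(A) is bijective for every A ∈ Art; i.e., 𝓓 ≅ 𝓕/Γ. -/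
open IsLocalRing

universe u v

variable {Λ : Type u} [CommRing Λ] [IsLocalRing Λ]

section HullHelpers

/-- An Artinian object of `Art` is a finite `Λ`-module. -/
theorem ArtAlg.finite (A : ArtAlg Λ) : Module.Finite Λ A.carrier := by
  obtain ⟨n, hn⟩ := (isArtinianRing_iff_isNilpotent_maximalIdeal A.carrier).mp A.art
  have key : ∀ j : ℕ, j ≤ n →
      ((maximalIdeal A.carrier ^ (n - j)).restrictScalars Λ : Submodule Λ A.carrier).FG := by
    intro j
    induction j with
    | zero =>
      intro _
      rw [Nat.sub_zero, hn]
      exact (Submodule.restrictScalars_bot Λ A.carrier A.carrier) ▸ Submodule.fg_bot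
    | succ j ih =>
      intro hj
      have h1 := ih (by omega)
      have e : n - j = (n - (j + 1)) + 1 := by omega
      set i := n - (j + 1) with hi
      rw [e] at h1
      obtain ⟨G, hG⟩ := (IsNoetherian.noetherian (maximalIdeal A.carrier ^ i) :
        (maximalIdeal A.carrier ^ i).FG)
      have h2 : ((maximalIdeal A.carrier ^ i).restrictScalars Λ : Submodule Λ A.carrier)
          = Submodule.span Λ (G : Set A.carrier) ⊔
            ((maximalIdeal A.carrier ^ (i + 1)).restrictScalars Λ) := by
        apply le_antisymm
        · intro x hx
          have hx' : x ∈ Submodule.span A.carrier (G : Set A.carrier) := by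
            rw [hG]; exact hx
          clear hx
          induction hx' using Submodule.span_induction with
          | mem x h => exact Submodule.mem_sup_left (Submodule.subset_span h)
          | zero => exact Submodule.zero_mem _
          | add x y _ _ hx hy => exact Submodule.add_mem _ hx hy
          | smul a x hx' hx =>
            obtain ⟨c, hc⟩ := A.resSurj a
            have : a • x = c • x + (a - algebraMap Λ A.carrier c) * x := by
              rw [Algebra.smul_def c x, smul_eq_mul]; ring
            rw [this]
            refine Submodule.add_mem _ (Submodule.smul_mem _ _ hx) (Submodule.mem_sup_right ?_)
            change _ ∈ maximalIdeal A.carrier ^ (i + 1)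
            rw [pow_succ']
            refine Ideal.mul_mem_mul hc ?_
            rw [← hG]; exact hx'
        · refine sup_le (Submodule.span_le.2 fun x hx => ?_) ?_
          · change x ∈ maximalIdeal A.carrier ^ i
            rw [← hG]; exact Submodule.subset_span hx
          · intro x hx
            exact Ideal.pow_le_pow_right (Nat.le_succ i) hx
      rw [h2]
      exact (Submodule.fg_span G.finite_toSet).sup h1
  have := key n le_rfl
  rw [Nat.sub_self, pow_zero, Ideal.one_eq_top] at this
  exact ⟨by simpa using this⟩

/-- The quotient of `F` by a proper ideal containing a power of the maximal ideal. -/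
def ProRepAlg.quo (F : ProRepAlg Λ) (I : Ideal F.carrier) (hI : I ≠ ⊤)
    (h : ∃ n, maximalIdeal F.carrier ^ n ≤ I) : ArtAlg Λ :=
  haveI : Nontrivial (F.carrier ⧸ I) := Ideal.Quotient.nontrivial_iff.mpr hI
  haveI : IsLocalRing (F.carrier ⧸ I) :=
    IsLocalRing.of_surjective' (Ideal.Quotient.mk I) Ideal.Quotient.mk_surjective
  haveI hl : IsLocalHom (Ideal.Quotient.mk I) :=
    IsLocalHom.of_surjective (Ideal.Quotient.mk I) Ideal.Quotient.mk_surjective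
  haveI hmap : (maximalIdeal F.carrier).map (Ideal.Quotient.mk I) =
      maximalIdeal (F.carrier ⧸ I) := by
    ext x
    obtain ⟨x, rfl⟩ := Ideal.Quotient.mk_surjective x
    simp [sup_eq_left.mpr (le_maximalIdeal hI)]
  { carrier := F.carrier ⧸ I
    art := by
      rw [isArtinianRing_iff_isNilpotent_maximalIdeal]
      obtain ⟨n, hn⟩ := h
      refine ⟨n, ?_⟩
      rw [← hmap, ← Ideal.map_pow, Ideal.zero_eq_bot, Ideal.map_eq_bot_iff_le_ker, Ideal.mk_ker]
      exact hn
    locHom := ⟨fun c hc => F.locHom.1 c (hl.1 _ hc)⟩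
    resSurj := by
      intro a
      obtain ⟨a, rfl⟩ := Ideal.Quotient.mk_surjective a
      obtain ⟨c, hc⟩ := F.resSurj a
      refine ⟨c, ?_⟩
      rw [← hmap]
      exact (map_sub (Ideal.Quotient.mk I) _ _) ▸ Ideal.mem_map_of_mem _ hc }

/-- The projection of `F` to its quotient. -/
def ProRepAlg.proj (F : ProRepAlg Λ) (I : Ideal F.carrier) (hI : I ≠ ⊤)
    (h : ∃ n, maximalIdeal F.carrier ^ n ≤ I) : (hFunctor F).obj (F.quo I hI h) :=
  ⟨Ideal.Quotient.mkₐ Λ I, by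
    haveI : Nontrivial (F.carrier ⧸ I) := Ideal.Quotient.nontrivial_iff.mpr hI
    exact IsLocalHom.of_surjective (Ideal.Quotient.mk I) Ideal.Quotient.mk_surjective⟩

theorem ProRepAlg.pow_ne_top (F : ProRepAlg Λ) (n : ℕ) :
    maximalIdeal F.carrier ^ (n + 1) ≠ ⊤ := fun h =>
  (maximalIdeal.isMaximal F.carrier).ne_top
    (top_le_iff.1 (h ▸ Ideal.pow_le_self (Nat.succ_ne_zero n)))

/-- `F / m^(n+1)`. -/
abbrev ProRepAlg.lev (F : ProRepAlg Λ) (n : ℕ) : ArtAlg Λ :=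
  F.quo (maximalIdeal F.carrier ^ (n + 1)) (F.pow_ne_top n) ⟨n + 1, le_rfl⟩

/-- The projection `F → F / m^(n+1)`. -/
abbrev ProRepAlg.pi (F : ProRepAlg Λ) (n : ℕ) : (hFunctor F).obj (F.lev n) :=
  F.proj (maximalIdeal F.carrier ^ (n + 1)) (F.pow_ne_top n) ⟨n + 1, le_rfl⟩

/-- Every point of `h_F` in `A` factors through `F / m^(n+1)` for large `n`. -/
theorem ProRepAlg.exists_factor (F : ProRepAlg Λ) {A : ArtAlg Λ} (x : (hFunctor F).obj A) :
    ∃ N, ∀ n, N ≤ n → ∃ f : ArtHom (F.lev n) A, (hFunctor F).map f (F.pi n) = x := by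
  obtain ⟨N, hN⟩ := (isArtinianRing_iff_isNilpotent_maximalIdeal A.carrier).mp A.art
  refine ⟨N, fun n hn => ?_⟩
  haveI := x.2
  have hle : (maximalIdeal F.carrier).map x.1.toRingHom ≤ maximalIdeal A.carrier :=
    ((local_hom_TFAE x.1.toRingHom).out 0 2).1 x.2
  have hk : ∀ a ∈ maximalIdeal F.carrier ^ (n + 1), x.1 a = 0 := by
    intro a ha
    have h1 : x.1.toRingHom a ∈ maximalIdeal A.carrier ^ N := by
      refine Ideal.pow_right_mono hle N ?_
      rw [← Ideal.map_pow]
      exact Ideal.mem_map_of_mem _ (Ideal.pow_le_pow_right (by omega) ha)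
    rw [hN] at h1
    simpa using h1
  refine ⟨⟨Ideal.Quotient.liftₐ _ x.1 hk, ⟨fun b hb => ?_⟩⟩, ?_⟩
  · obtain ⟨a, rfl⟩ := Ideal.Quotient.mk_surjective b
    have : IsUnit (x.1 a) := hb
    exact (x.2.1 a this).map (Ideal.Quotient.mk _)
  · exact Subtype.ext (AlgHom.ext fun a => rfl)

/-- Transition maps. -/
def ProRepAlg.trans (F : ProRepAlg Λ) {m n : ℕ} (h : m ≤ n) : ArtHom (F.lev n) (F.lev m) where
  toAlgHom := Ideal.Quotient.factorₐ Λ (Ideal.pow_le_pow_right (Nat.succ_le_succ h))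
  isLocal := by
    refine ⟨fun b hb => ?_⟩
    obtain ⟨a, rfl⟩ := Ideal.Quotient.mk_surjective b
    exact (((F.pi m).2.1 a hb)).map (Ideal.Quotient.mk _)

theorem ProRepAlg.trans_surj (F : ProRepAlg Λ) {m n : ℕ} (h : m ≤ n) :
    Function.Surjective (F.trans h).toAlgHom := by
  intro b
  obtain ⟨a, rfl⟩ := Ideal.Quotient.mk_surjective b
  exact ⟨Ideal.Quotient.mk _ a, rfl⟩

/-- The fibre product in `Art`. -/
theorem exists_fibreProduct [IsNoetherianRing Λ] {A B C : ArtAlg Λ} (f : ArtHom A B)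
    (g : ArtHom C B) : ∃ (R : ArtAlg Λ) (p : ArtHom R A) (r : ArtHom R C),
      IsFibreProduct f g p r := by
  let S : Subalgebra Λ (A.carrier × C.carrier) :=
    AlgHom.equalizer (f.toAlgHom.comp (AlgHom.fst Λ A.carrier C.carrier))
      (g.toAlgHom.comp (AlgHom.snd Λ A.carrier C.carrier))
  have hS : ∀ s : S, f.toAlgHom s.1.1 = g.toAlgHom s.1.2 := fun s => s.2
  let p : S →ₐ[Λ] A.carrier := (AlgHom.fst Λ A.carrier C.carrier).comp S.val
  let r : S →ₐ[Λ] C.carrier := (AlgHom.snd Λ A.carrier C.carrier).comp S.val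
  have unitAC : ∀ s : S, IsUnit (p s) ↔ IsUnit (r s) := by
    intro s
    constructor
    · intro h
      apply g.isLocal.1
      have : IsUnit (f.toAlgHom s.1.1) := h.map f.toAlgHom
      rw [hS s] at this
      exact this
    · intro h
      apply f.isLocal.1
      have : IsUnit (g.toAlgHom s.1.2) := h.map g.toAlgHom
      rw [← hS s] at this
      exact this
  have unitS : ∀ s : S, IsUnit (p s) → IsUnit s := by
    intro s h
    obtain ⟨a, ha⟩ := h.exists_right_inv
    obtain ⟨c, hc⟩ := ((unitAC s).1 h).exists_right_inv
    have ha' : f.toAlgHom s.1.1 * f.toAlgHom a = 1 := by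
      rw [← map_mul, ← map_one f.toAlgHom]; exact congrArg _ ha
    have hc' : f.toAlgHom s.1.1 * g.toAlgHom c = 1 := by
      rw [hS s, ← map_mul, ← map_one g.toAlgHom]; exact congrArg _ hc
    have hac : f.toAlgHom a = g.toAlgHom c := by
      calc f.toAlgHom a = f.toAlgHom a * (f.toAlgHom s.1.1 * g.toAlgHom c) := by rw [hc', mul_one]
        _ = (f.toAlgHom s.1.1 * f.toAlgHom a) * g.toAlgHom c := by ring
        _ = g.toAlgHom c := by rw [ha', one_mul]
    refine IsUnit.of_mul_eq_one (⟨(a, c), hac⟩ : S) ?_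
    exact Subtype.ext (Prod.ext ha hc)
  haveI hpl : IsLocalHom p.toRingHom := ⟨unitS⟩
  haveI hrl : IsLocalHom r.toRingHom := ⟨fun s h => unitS s ((unitAC s).2 h)⟩
  haveI : IsLocalRing S := p.toRingHom.domain_isLocalRing
  haveI := A.finite
  haveI := C.finite
  haveI : IsNoetherian Λ S := inferInstanceAs (IsNoetherian Λ (Subalgebra.toSubmodule S))
  haveI : IsNoetherianRing S := isNoetherian_of_tower Λ inferInstance
  have nil : ∀ {A : ArtAlg Λ} (a : A.carrier), ¬ IsUnit a → IsNilpotent a := by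
    intro A a ha
    obtain ⟨N, hN⟩ := (isArtinianRing_iff_isNilpotent_maximalIdeal A.carrier).mp A.art
    refine ⟨N, ?_⟩
    have := Ideal.pow_mem_pow ((mem_maximalIdeal a).2 ha) N
    rw [hN] at this
    simpa using this
  haveI : IsArtinianRing S := by
    rw [isArtinianRing_iff_isNilpotent_maximalIdeal]
    have hle : maximalIdeal S ≤ nilradical S := by
      intro s hs
      have hs' : ¬ IsUnit s := hs
      obtain ⟨n, hn⟩ := nil (p s) (fun h => hs' (unitS s h))
      obtain ⟨m, hm⟩ := nil (r s) (fun h => hs' (unitS s ((unitAC s).2 h)))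
      refine ⟨n + m, Subtype.ext (Prod.ext ?_ ?_)⟩
      · change (p s) ^ (n + m) = 0
        rw [pow_add, hn, zero_mul]
      · change (r s) ^ (n + m) = 0
        rw [pow_add, hm, mul_zero]
    obtain ⟨n, hn⟩ := IsNoetherianRing.isNilpotent_nilradical S
    refine ⟨n, ?_⟩
    rw [Ideal.zero_eq_bot] at hn ⊢
    exact le_bot_iff.1 (hn ▸ Ideal.pow_right_mono hle n)
  haveI : IsLocalHom (algebraMap Λ S) :=
    ⟨fun c hc => A.locHom.1 c (by
      have := hc.map p
      rwa [AlgHom.commutes] at this)⟩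
  let R : ArtAlg Λ :=
    { carrier := S
      resSurj := by
        intro s
        obtain ⟨c, hc⟩ := A.resSurj (p s)
        refine ⟨c, fun h => hc ?_⟩
        have := IsUnit.map p h
        rwa [map_sub, AlgHom.commutes] at this }
  refine ⟨R, ⟨p, hpl⟩, ⟨r, hrl⟩, hS, ?_⟩
  intro a c hac
  exact ⟨(⟨(a, c), hac⟩ : S), ⟨rfl, rfl⟩, fun s hs => Subtype.ext (Prod.ext hs.1 hs.2)⟩

/-- A surjective endomorphism of a Noetherian ring is injective. -/
theorem injective_of_surjective_ringEnd {R : Type u} [CommRing R] [IsNoetherianRing R]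
    (φ : R →+* R) (h : Function.Surjective φ) : Function.Injective φ := by
  have mono : ∀ n, RingHom.ker (φ ^ n) ≤ RingHom.ker (φ ^ (n + 1)) := by
    intro n x hx
    rw [RingHom.mem_ker] at hx ⊢
    rw [pow_succ']
    change φ ((φ ^ n) x) = 0
    rw [hx, map_zero]
  obtain ⟨n, hn⟩ := monotone_stabilizes_iff_noetherian.2 (inferInstance : IsNoetherian R R)
    ⟨fun n => RingHom.ker (φ ^ n), monotone_nat_of_le_succ mono⟩
  have hs : ∀ n, Function.Surjective (φ ^ n : R →+* R) := by
    intro n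
    induction n with
    | zero => exact fun x => ⟨x, rfl⟩
    | succ n ih =>
      intro x
      obtain ⟨y, rfl⟩ := h x
      obtain ⟨z, rfl⟩ := ih y
      exact ⟨z, by rw [pow_succ']; rfl⟩
  rw [injective_iff_map_eq_zero]
  intro x hx
  obtain ⟨y, rfl⟩ := hs n x
  have h1 : y ∈ RingHom.ker (φ ^ (n + 1)) := by
    rw [RingHom.mem_ker, pow_succ']; exact hx
  have h2 : RingHom.ker (φ ^ n) = RingHom.ker (φ ^ (n + 1)) := hn (n + 1) (Nat.le_succ n)
  rw [← h2] at h1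
  exact h1

/-- A local endomorphism of `F` acting trivially on the cotangent space is bijective. -/
theorem ProRepAlg.bijective_of_trivial (F : ProRepAlg Λ) (γ : LocHom Λ F.carrier F.carrier)
    (h : ∀ x ∈ maximalIdeal F.carrier, γ.1 x - x ∈ maximalIdeal F.carrier ^ 2 ⊔
      Ideal.map (algebraMap Λ F.carrier) (maximalIdeal Λ)) : Function.Bijective γ.1 := by
  set m := maximalIdeal F.carrier with hm
  have hle : m.map γ.1.toRingHom ≤ m := ((local_hom_TFAE γ.1.toRingHom).out 0 2).1 γ.2
  have hΛ : Ideal.map (algebraMap Λ F.carrier) (maximalIdeal Λ) ≤ m.map γ.1.toRingHom := by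
    rw [Ideal.map_le_iff_le_comap]
    intro c hc
    have h0 : (maximalIdeal Λ).map (algebraMap Λ F.carrier) ≤ m :=
      ((local_hom_TFAE (algebraMap Λ F.carrier)).out 0 2).1 F.locHom
    have h1 : algebraMap Λ F.carrier c ∈ m := h0 (Ideal.mem_map_of_mem _ hc)
    have h2 := Ideal.mem_map_of_mem γ.1.toRingHom h1
    have h3 : γ.1.toRingHom (algebraMap Λ F.carrier c) = algebraMap Λ F.carrier c :=
      γ.1.commutes c
    rwa [h3] at h2
  have hge : m ≤ m.map γ.1.toRingHom := by
    refine Submodule.le_of_le_smul_of_le_jacobson_bot (I := m)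
      (IsNoetherian.noetherian m) (le_of_eq (jacobson_eq_maximalIdeal _ bot_ne_top).symm) ?_
    intro x hx
    have h1 := h x hx
    have h2 : m ^ 2 ⊔ Ideal.map (algebraMap Λ F.carrier) (maximalIdeal Λ) ≤
        m.map γ.1.toRingHom ⊔ m • m := by
      refine sup_le ?_ (hΛ.trans le_sup_left)
      rw [pow_two, ← smul_eq_mul]
      exact le_sup_right
    have h3 : γ.1 x ∈ m.map γ.1.toRingHom ⊔ m • m :=
      Submodule.mem_sup_left (Ideal.mem_map_of_mem γ.1.toRingHom hx)
    have := Submodule.sub_mem _ h3 (h2 h1)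
    simpa using this
  have heq : m.map γ.1.toRingHom = m := le_antisymm hle hge
  have hsurj : Function.Surjective γ.1.toRingHom := by
    haveI : IsHausdorff (m.map γ.1.toRingHom) F.carrier := by
      rw [heq]; exact F.complete.toIsHausdorff
    haveI : IsPrecomplete m F.carrier := F.complete.toIsPrecomplete
    refine surjective_of_mk_map_comp_surjective (I := m) γ.1.toRingHom ?_
    intro b
    obtain ⟨a, rfl⟩ := Ideal.Quotient.mk_surjective b
    obtain ⟨c, hc⟩ := F.resSurj a
    refine ⟨algebraMap Λ F.carrier c, ?_⟩
    have h3 : γ.1.toRingHom (algebraMap Λ F.carrier c) = algebraMap Λ F.carrier c :=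
      γ.1.commutes c
    rw [RingHom.comp_apply, h3]
    refine (Ideal.Quotient.eq.2 ?_).symm
    rw [heq]; exact hc
  exact ⟨injective_of_surjective_ringEnd γ.1.toRingHom hsurj, hsurj⟩

/-- Endomorphisms of `F` stabilizing `q` act trivially on the cotangent space. -/
theorem ProRepAlg.trivial_of_stab (F : ProRepAlg Λ) (𝓓 : ArtFunctor Λ)
    (q : ArtNatTrans (hFunctor F) 𝓓)
    (hkv : ∀ A : ArtAlg Λ, IsKV A → Function.Bijective (q.app A))
    (γ : LocHom Λ F.carrier F.carrier)
    (h : ∀ (B : ArtAlg Λ) (z : (hFunctor F).obj B), q.app B (precompEnd γ z) = q.app B z) :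
    ∀ x ∈ maximalIdeal F.carrier, γ.1 x - x ∈ maximalIdeal F.carrier ^ 2 ⊔
      Ideal.map (algebraMap Λ F.carrier) (maximalIdeal Λ) := by
  intro x _
  set I := maximalIdeal F.carrier ^ 2 ⊔
      Ideal.map (algebraMap Λ F.carrier) (maximalIdeal Λ) with hIdef
  have hIm : I ≤ maximalIdeal F.carrier :=
    sup_le (Ideal.pow_le_self two_ne_zero)
      (((local_hom_TFAE (algebraMap Λ F.carrier)).out 0 2).1 F.locHom)
  have hI : I ≠ ⊤ := fun e =>
    (maximalIdeal.isMaximal F.carrier).ne_top (top_le_iff.1 (e ▸ hIm))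
  have hn : ∃ n, maximalIdeal F.carrier ^ n ≤ I := ⟨2, le_sup_left⟩
  have hK : IsKV (F.quo I hI hn) := by
    constructor
    · have hmap : maximalIdeal (F.quo I hI hn).carrier ≤
          (maximalIdeal F.carrier).map (Ideal.Quotient.mk I) := by
        intro b hb
        obtain ⟨a, rfl⟩ := Ideal.Quotient.mk_surjective b
        refine Ideal.mem_map_of_mem _ fun ha => hb ?_
        exact ha.map (Ideal.Quotient.mk I)
      have h0 : (maximalIdeal F.carrier).map (Ideal.Quotient.mk I) ^ 2 ≤ ⊥ := by
        rw [← Ideal.map_pow, Ideal.map_le_iff_le_comap]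
        intro a ha
        exact Ideal.Quotient.eq_zero_iff_mem.2 (Ideal.mem_sup_left ha)
      exact le_bot_iff.1 ((Ideal.pow_right_mono hmap 2).trans h0)
    · refine le_bot_iff.1 ?_
      rw [Ideal.map_le_iff_le_comap]
      intro c hc
      exact Ideal.Quotient.eq_zero_iff_mem.2
        (Ideal.mem_sup_right (Ideal.mem_map_of_mem (algebraMap Λ F.carrier) hc))
  have := (hkv _ hK).1 (h _ (F.proj I hI hn))
  have h2 : Ideal.Quotient.mk I (γ.1 x) = Ideal.Quotient.mk I x :=
    congrArg (fun z : LocHom Λ F.carrier (F.quo I hI hn).carrier => z.1 x) this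
  exact Ideal.Quotient.eq.1 h2

/-- Any `h : F → F/m^(N+1)` with the same class as the projection lifts to an
automorphism stabilizing `q`. -/
theorem ProRepAlg.exists_lift (F : ProRepAlg Λ) (𝓓 : ArtFunctor Λ)
    (q : ArtNatTrans (hFunctor F) 𝓓) (hsm : FormallySmooth' q)
    (hkv : ∀ A : ArtAlg Λ, IsKV A → Function.Bijective (q.app A)) (N : ℕ)
    (h : (hFunctor F).obj (F.lev N)) (hh : q.app _ h = q.app _ (F.pi N)) :
    ∃ g : F.carrier ≃ₐ[Λ] F.carrier,
      (∀ (B : ArtAlg Λ) (z : (hFunctor F).obj B), q.app B (precompAut g z) = q.app B z) ∧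
      precompAut g (F.pi N) = h := by
  let T : ℕ → Type u := fun n =>
    {k : (hFunctor F).obj (F.lev (n + N)) // q.app _ k = q.app _ (F.pi (n + N))}
  have step : ∀ n (k : T n), ∃ k' : T (n + 1),
      (hFunctor F).map (F.trans (show n + N ≤ n + 1 + N by omega)) k'.1 = k.1 := by
    intro n k
    obtain ⟨a, ha, ha'⟩ := hsm (F.trans (show n + N ≤ n + 1 + N by omega)) (F.trans_surj _)
      k.1 (q.app _ (F.pi (n + 1 + N))) (by
        rw [k.2, ← q.naturality]; rfl)
    exact ⟨⟨a, ha'⟩, ha⟩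
  choose nxt hnxt using step
  have cast0 : ∃ k0 : T 0, ∀ a, ∀ b : F.carrier, h.1 a = Ideal.Quotient.mk _ b →
      k0.1.1 a = Ideal.Quotient.mk _ b := by
    have : ∀ M, M = N → ∃ k : (hFunctor F).obj (F.lev M),
        q.app _ k = q.app _ (F.pi M) ∧ ∀ a, ∀ b : F.carrier, h.1 a = Ideal.Quotient.mk _ b →
          k.1 a = Ideal.Quotient.mk _ b := by
      rintro M rfl
      exact ⟨h, hh, fun _ _ e => e⟩
    obtain ⟨k, h1, h2⟩ := this (0 + N) (Nat.zero_add N)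
    exact ⟨⟨k, h1⟩, h2⟩
  obtain ⟨k0, hk0⟩ := cast0
  let s : ∀ n, T n := fun n => Nat.rec k0 nxt n
  have hs : ∀ n, (hFunctor F).map (F.trans (show n + N ≤ n + 1 + N by omega)) (s (n + 1)).1
      = (s n).1 := fun n => hnxt n (s n)
  set m := maximalIdeal F.carrier with hm
  -- representatives
  have hrep : ∀ n a, ∃ b : F.carrier, (s n).1.1 a = Ideal.Quotient.mk (m ^ (n + N + 1)) b :=
    fun n a => (Ideal.Quotient.mk_surjective _).imp fun _ e => e.symm
  have hcompat : ∀ n d a, ∀ b : F.carrier,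
      (s (n + d)).1.1 a = Ideal.Quotient.mk (m ^ (n + d + N + 1)) b →
      (s n).1.1 a = Ideal.Quotient.mk (m ^ (n + N + 1)) b := by
    intro n d
    induction d with
    | zero => exact fun a b e => e
    | succ d ih =>
      intro a b e
      apply ih a b
      have e1 := congrArg (fun z : LocHom Λ F.carrier (F.lev (n + d + N)).carrier => z.1 a)
        (hs (n + d))
      rw [← e1]
      change (F.trans (show n + d + N ≤ n + d + 1 + N by omega)).toAlgHom ((s (n + d + 1)).1.1 a) = _
      have e2 : (s (n + d + 1)).1.1 a = Ideal.Quotient.mk (m ^ (n + d + 1 + N + 1)) b := e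
      rw [e2]
      rfl
  let f : ∀ n, F.carrier →ₐ[Λ] F.carrier ⧸ m ^ n := fun n =>
    (Ideal.Quotient.factorₐ Λ (Ideal.pow_le_pow_right (show n ≤ n + N + 1 by omega))).comp
      (s n).1.1
  have hfs : ∀ n a, ∀ b : F.carrier, (s n).1.1 a = Ideal.Quotient.mk (m ^ (n + N + 1)) b →
      f n a = Ideal.Quotient.mk (m ^ n) b := fun n a b e =>
    congrArg (Ideal.Quotient.factorₐ Λ
      (Ideal.pow_le_pow_right (show n ≤ n + N + 1 by omega))) e
  have hf : ∀ {i n : ℕ} (hle : i ≤ n),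
      (Ideal.Quotient.factorₐ Λ (Ideal.pow_le_pow_right hle)).comp (f n) = f i := by
    intro i n hle
    obtain ⟨d, rfl⟩ := Nat.exists_eq_add_of_le hle
    ext a
    obtain ⟨b, hb⟩ := hrep (i + d) a
    have hb' := hcompat i d a b hb
    rw [AlgHom.comp_apply, hfs _ a b hb, hfs _ a b hb']
    rfl
  haveI : IsAdicComplete m F.carrier := F.complete
  let φ : F.carrier →ₐ[Λ] F.carrier := IsAdicComplete.liftAlgHom m f hf
  have hφ : ∀ n a, Ideal.Quotient.mk (m ^ n) (φ a) = f n a :=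
    fun n a => IsAdicComplete.mk_liftAlgHom m f hf n a
  have hφs : ∀ n a, Ideal.Quotient.mk (m ^ (n + N + 1)) (φ a) = (s n).1.1 a := by
    intro n a
    have h1 := hφ (n + N + 1) a
    obtain ⟨b, hb⟩ := hrep (n + (N + 1)) a
    have hb' := hcompat n (N + 1) a b hb
    rw [h1, hb']
    exact hfs (n + (N + 1)) a b hb
  have hloc : IsLocalHom φ.toRingHom := by
    refine ⟨fun a ha => (s 0).1.2.1 a ?_⟩
    have h1 : IsUnit (Ideal.Quotient.mk (m ^ (0 + N + 1)) (φ a)) :=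
      IsUnit.map (Ideal.Quotient.mk (m ^ (0 + N + 1))) ha
    rw [hφs 0 a] at h1
    exact h1
  let γ : LocHom Λ F.carrier F.carrier := ⟨φ, hloc⟩
  have hγ : ∀ n, precompEnd γ (F.pi (n + N)) = (s n).1 := fun n =>
    Subtype.ext (AlgHom.ext fun a => hφs n a)
  have hstab : ∀ (B : ArtAlg Λ) (z : (hFunctor F).obj B),
      q.app B (precompEnd γ z) = q.app B z := by
    intro B z
    obtain ⟨M, hM⟩ := F.exists_factor z
    obtain ⟨w, rfl⟩ := hM (M + N) (Nat.le_add_right M N)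
    have e : precompEnd γ ((hFunctor F).map w (F.pi (M + N))) =
        (hFunctor F).map w (precompEnd γ (F.pi (M + N))) := rfl
    rw [e, q.naturality, q.naturality, hγ, (s M).2]
  have hbij := F.bijective_of_trivial γ (F.trivial_of_stab 𝓓 q hkv γ hstab)
  have hpre : ∀ {B : ArtAlg Λ} (z : (hFunctor F).obj B),
      precompAut (AlgEquiv.ofBijective γ.1 hbij) z = precompEnd γ z := fun z =>
    Subtype.ext (AlgHom.ext fun a => rfl)
  refine ⟨AlgEquiv.ofBijective γ.1 hbij, fun B z => by rw [hpre]; exact hstab B z, ?_⟩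
  rw [hpre]
  refine Subtype.ext (AlgHom.ext fun a => ?_)
  obtain ⟨b, hb⟩ := Ideal.Quotient.mk_surjective (h.1 a)
  have h1 := hk0 a b hb.symm
  have h2 : Ideal.Quotient.mk (m ^ (0 + N + 1)) (φ a) = Ideal.Quotient.mk (m ^ (0 + N + 1)) b :=
    (hφs 0 a).trans h1
  rw [Nat.zero_add] at h2
  exact h2.trans hb

end HullHelpers

/-- If `q : h_F → 𝓓` is a hull and `𝓓` satisfies the fibre-product
surjectivity condition, then the subgroup `Γ` of automorphisms `g` with `q ∘ g = q`
acts trivially on `TF`, and `𝓕(A)/Γ → 𝓓(A)` is bijective for every `A`;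
i.e. `𝓓 ≅ 𝓕/Γ`. -/
theorem hull_is_quotient_by_stabilizer {Λ : Type u} [CommRing Λ] [IsLocalRing Λ] [IsNoetherianRing Λ]
    [IsAdicComplete (maximalIdeal Λ) Λ]
    (F : ProRepAlg Λ) (𝓓 : ArtFunctor Λ) (q : ArtNatTrans (hFunctor F) 𝓓)
    (hsm : FormallySmooth' q)
    (hkv : ∀ A : ArtAlg Λ, IsKV A → Function.Bijective (q.app A))
    (hfib : ∀ {A B C R : ArtAlg Λ} (f : ArtHom A B) (g : ArtHom C B)
      (p : ArtHom R A) (q : ArtHom R C), IsFibreProduct f g p q →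
      ∀ (dA : (𝓓).obj A) (dC : (𝓓).obj C),
        (𝓓).map f dA = (𝓓).map g dC →
        ∃ dR : (𝓓).obj R, (𝓓).map p dR = dA ∧ (𝓓).map q dR = dC) :
    (∀ g : F.carrier ≃ₐ[Λ] F.carrier,
        (∀ (B : ArtAlg Λ) (z : (hFunctor F).obj B), q.app B (precompAut g z) = q.app B z) →
        ActsTriviallyOnTangent F g) ∧
      ∀ A : ArtAlg Λ,
        (∀ d : 𝓓.obj A, ∃ x : (hFunctor F).obj A, q.app A x = d) ∧
        (∀ x y : (hFunctor F).obj A, q.app A x = q.app A y →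
          ∃ g : F.carrier ≃ₐ[Λ] F.carrier,
            (∀ (B : ArtAlg Λ) (z : (hFunctor F).obj B),
              q.app B (precompAut g z) = q.app B z) ∧
            precompAut g x = y) := by
  refine ⟨fun g hg => ?_, fun A => ?_⟩
  · exact F.trivial_of_stab 𝓓 q hkv ⟨(g : F.carrier →ₐ[Λ] F.carrier),
      AlgEquiv.isLocalHom_toRingHom g⟩ fun B z => (hg B z)
  have hsurj : ∀ (A : ArtAlg Λ) (d : 𝓓.obj A), ∃ x : (hFunctor F).obj A, q.app A x = d := by
    intro A d
    obtain ⟨K, π, hπ, hK⟩ : ∃ (K : ArtAlg Λ) (π : ArtHom A K),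
        Function.Surjective π.toAlgHom ∧ IsKV K := by
      haveI hl : IsLocalHom (Ideal.Quotient.mk (maximalIdeal A.carrier)) :=
        IsLocalHom.of_surjective _ Ideal.Quotient.mk_surjective
      haveI : Field (A.carrier ⧸ maximalIdeal A.carrier) :=
        Ideal.Quotient.field (maximalIdeal A.carrier)
      haveI : IsLocalRing (A.carrier ⧸ maximalIdeal A.carrier) :=
        IsLocalRing.of_surjective' (Ideal.Quotient.mk _) Ideal.Quotient.mk_surjective
      have hmb : maximalIdeal (A.carrier ⧸ maximalIdeal A.carrier) = ⊥ := by
        refine le_bot_iff.1 fun b hb => ?_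
        obtain ⟨a, rfl⟩ := Ideal.Quotient.mk_surjective b
        refine Ideal.Quotient.eq_zero_iff_mem.2 fun ha => hb ?_
        exact ha.map (Ideal.Quotient.mk _)
      let K : ArtAlg Λ :=
        { carrier := A.carrier ⧸ maximalIdeal A.carrier
          locHom := ⟨fun c hc => A.locHom.1 c (hl.1 _ hc)⟩
          resSurj := by
            intro a
            obtain ⟨a, rfl⟩ := Ideal.Quotient.mk_surjective a
            obtain ⟨c, hc⟩ := A.resSurj a
            refine ⟨c, ?_⟩
            rw [hmb]
            exact (Ideal.Quotient.eq_zero_iff_mem.2 hc :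
              Ideal.Quotient.mk _ (a - algebraMap Λ A.carrier c) = 0) }
      refine ⟨K, ⟨Ideal.Quotient.mkₐ Λ _, hl⟩, Ideal.Quotient.mk_surjective, ?_, ?_⟩
      · refine le_bot_iff.1 ((Ideal.pow_le_self two_ne_zero).trans hmb.le)
      · refine le_bot_iff.1 ?_
        rw [← hmb]
        exact ((local_hom_TFAE (algebraMap Λ K.carrier)).out 0 2).1 K.locHom
    obtain ⟨b, hb⟩ := (hkv K hK).2 (𝓓.map π d)
    obtain ⟨a, _, ha⟩ := hsm π hπ b d hb
    exact ⟨a, ha⟩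
  refine ⟨hsurj A, fun x y hxy => ?_⟩
  obtain ⟨N₁, h₁⟩ := F.exists_factor x
  obtain ⟨N₂, h₂⟩ := F.exists_factor y
  obtain ⟨f, hf⟩ := h₁ (max N₁ N₂) (le_max_left _ _)
  obtain ⟨f', hf'⟩ := h₂ (max N₁ N₂) (le_max_right _ _)
  generalize max N₁ N₂ = N at f f' hf hf'
  obtain ⟨R, p, r, hR⟩ := exists_fibreProduct f f'
  obtain ⟨dR, hp, hr⟩ := hfib f f' p r hR (q.app _ (F.pi N)) (q.app _ (F.pi N)) (by
    rw [← q.naturality, ← q.naturality, hf, hf', hxy])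
  obtain ⟨ρ, rfl⟩ := hsurj R dR
  rw [← q.naturality] at hp hr
  obtain ⟨g₁, hs₁, hg₁⟩ := F.exists_lift 𝓓 q hsm hkv N _ hp
  obtain ⟨g₂, hs₂, hg₂⟩ := F.exists_lift 𝓓 q hsm hkv N _ hr
  have key : precompAut g₁ x = precompAut g₂ y := by
    have e1 : precompAut g₁ x = (hFunctor F).map f (precompAut g₁ (F.pi N)) := by
      rw [← hf]; rfl
    have e2 : precompAut g₂ y = (hFunctor F).map f' (precompAut g₂ (F.pi N)) := by
      rw [← hf']; rfl
    rw [e1, e2, hg₁, hg₂]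
    exact Subtype.ext (AlgHom.ext fun a => hR.1 (ρ.1 a))
  have hinv : ∀ {B : ArtAlg Λ} (z : (hFunctor F).obj B),
      precompAut g₂ (precompAut g₂.symm z) = z := fun z =>
    Subtype.ext (AlgHom.ext fun a =>
      show z.1 (g₂.symm (g₂ a)) = z.1 a by rw [g₂.symm_apply_apply])
  have hinv' : ∀ {B : ArtAlg Λ} (z : (hFunctor F).obj B),
      precompAut g₂.symm (precompAut g₂ z) = z := fun z =>
    Subtype.ext (AlgHom.ext fun a =>
      show z.1 (g₂ (g₂.symm a)) = z.1 a by rw [g₂.apply_symm_apply])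
  have hcomp : ∀ {B : ArtAlg Λ} (z : (hFunctor F).obj B),
      precompAut (g₂.symm.trans g₁) z = precompAut g₂.symm (precompAut g₁ z) := fun z =>
    Subtype.ext (AlgHom.ext fun a => rfl)
  refine ⟨g₂.symm.trans g₁, fun B z => ?_, ?_⟩
  · rw [hcomp, ← hs₂, hinv, hs₁]
  · rw [hcomp, key, hinv']
end

section
/- (Main theorem) For a functor 𝓓 : Art → Sets, the following are equivalent: (i) there exists a complete Noetherian local Λ-algebra F and a subgroup Γ ⊆ Aut_Λ(F) acting trivially on the tangent space TF such that 𝓓 ≅ Hom_Λ(F,−)/Γ; (ii) 𝓓 has a hull and for all morphisms A → B ← C in Art, the map 𝓓(A ×_B C) → 𝓓(A) ×_{𝓓(B)} 𝓓(C) is surjective. -/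
open IsLocalRing

universe u v

variable {Λ : Type u} [CommRing Λ] [IsLocalRing Λ]

/-! ### Quotients of `F` and subalgebras of `A` as objects of `Art` -/

theorem quot_isLocalRing {R : Type u} [CommRing R] [IsLocalRing R] (I : Ideal R)
    (hI : I ≤ maximalIdeal R) : IsLocalRing (R ⧸ I) :=
  have : Nontrivial (R ⧸ I) := Ideal.Quotient.nontrivial_iff.mpr
    (fun h => (maximalIdeal.isMaximal R).ne_top (top_le_iff.mp (h ▸ hI)))
  IsLocalRing.of_surjective' (Ideal.Quotient.mk I) Ideal.Quotient.mk_surjective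

theorem quot_maximalIdeal {R : Type u} [CommRing R] [IsLocalRing R] (I : Ideal R)
    [IsLocalRing (R ⧸ I)] :
    maximalIdeal (R ⧸ I) = (maximalIdeal R).map (Ideal.Quotient.mk I) := by
  have := IsLocalHom.of_surjective (Ideal.Quotient.mk I) Ideal.Quotient.mk_surjective
  ext x
  obtain ⟨x, rfl⟩ := Ideal.Quotient.mk_surjective x
  constructor
  · intro h
    refine Ideal.mem_map_of_mem _ ?_
    rw [mem_maximalIdeal] at h ⊢
    exact fun hx => h (hx.map _)
  · intro h
    have : (maximalIdeal R).map (Ideal.Quotient.mk I) ≤ maximalIdeal (R ⧸ I) := by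
      rw [Ideal.map_le_iff_le_comap]
      intro y hy
      rw [Ideal.mem_comap, mem_maximalIdeal]
      rw [mem_maximalIdeal] at hy
      exact fun h => hy (this.1 y h)
    exact this h

/-- The quotient `F/I` as an object of `Art`. -/
abbrev quotArt (F : ProRepAlg Λ) (I : Ideal F.carrier) (hI : I ≤ maximalIdeal F.carrier)
    (hn : ∃ n : ℕ, maximalIdeal F.carrier ^ n ≤ I) : ArtAlg Λ :=
  haveI hl : IsLocalRing (F.carrier ⧸ I) := quot_isLocalRing I hI
  { carrier := F.carrier ⧸ I
    loc := hl
    art := by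
      rw [isArtinianRing_iff_isNilpotent_maximalIdeal]
      obtain ⟨n, hn⟩ := hn
      refine ⟨n, ?_⟩
      rw [quot_maximalIdeal, ← Ideal.map_pow, Ideal.zero_eq_bot, eq_bot_iff,
        Ideal.map_le_iff_le_comap]
      intro x hx
      rw [Ideal.mem_comap, Ideal.mem_bot, Ideal.Quotient.eq_zero_iff_mem]
      exact hn hx
    locHom := by
      have := IsLocalHom.of_surjective (Ideal.Quotient.mk I) Ideal.Quotient.mk_surjective
      refine ⟨fun a h => ?_⟩
      refine F.locHom.1 a (this.1 _ h)
    resSurj := by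
      intro a
      obtain ⟨a, rfl⟩ := Ideal.Quotient.mk_surjective a
      obtain ⟨c, hc⟩ := F.resSurj a
      refine ⟨c, ?_⟩
      rw [quot_maximalIdeal]
      exact Ideal.mem_map_of_mem (Ideal.Quotient.mk I) hc }

/-- The projection `F → F/I`. -/
def quotProj (F : ProRepAlg Λ) (I : Ideal F.carrier) (hI : I ≤ maximalIdeal F.carrier)
    (hn : ∃ n : ℕ, maximalIdeal F.carrier ^ n ≤ I) :
    (hFunctor F).obj (quotArt F I hI hn) :=
  ⟨Ideal.Quotient.mkₐ Λ I, by
    have hl : IsLocalRing (F.carrier ⧸ I) := quot_isLocalRing I hI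
    exact IsLocalHom.of_surjective (Ideal.Quotient.mk I) Ideal.Quotient.mk_surjective⟩

/-- A map `F → A` killing `I` factors over `F/I`. -/
theorem exists_factor (F : ProRepAlg Λ) (I : Ideal F.carrier) (hI : I ≤ maximalIdeal F.carrier)
    (hn : ∃ n : ℕ, maximalIdeal F.carrier ^ n ≤ I) {A : ArtAlg Λ} (x : (hFunctor F).obj A)
    (hx : ∀ a ∈ I, x.1 a = 0) :
    ∃ f : ArtHom (quotArt F I hI hn) A,
      (hFunctor F).map f (quotProj F I hI hn) = x ∧
      ∀ a, f.toAlgHom (Ideal.Quotient.mk I a) = x.1 a := by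
  refine ⟨⟨Ideal.Quotient.liftₐ I x.1 hx, ⟨?_⟩⟩, ?_, fun a => rfl⟩
  · intro a ha
    obtain ⟨a, rfl⟩ := Ideal.Quotient.mk_surjective a
    exact (x.2.1 a ha).map _
  · exact Subtype.ext (AlgHom.ext fun a => rfl)

theorem map_mem_maximalIdeal {R S : Type u} [CommRing R] [CommRing S] [IsLocalRing R]
    [IsLocalRing S] (f : R →+* S) (hf : IsLocalHom f) {a : R} (ha : a ∈ maximalIdeal R) :
    f a ∈ maximalIdeal S := by
  rw [mem_maximalIdeal] at ha ⊢
  exact fun h => ha (hf.1 a h)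

theorem kills_pow (F : ProRepAlg Λ) {A : ArtAlg Λ} (x : (hFunctor F).obj A) :
    ∃ N : ℕ, ∀ n, N ≤ n → ∀ a ∈ maximalIdeal F.carrier ^ n, x.1 a = 0 := by
  obtain ⟨N, hN⟩ := (isArtinianRing_iff_isNilpotent_maximalIdeal A.carrier).mp A.art
  refine ⟨N, fun n hn a ha => ?_⟩
  have h1 : (maximalIdeal F.carrier).map x.1.toRingHom ≤ maximalIdeal A.carrier := by
    rw [Ideal.map_le_iff_le_comap]
    exact fun y hy => map_mem_maximalIdeal _ x.2 hy
  have h2 : x.1 a ∈ ((maximalIdeal F.carrier) ^ N).map x.1.toRingHom :=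
    Ideal.mem_map_of_mem x.1.toRingHom (Ideal.pow_le_pow_right hn ha)
  rw [Ideal.map_pow] at h2
  have h3 := Ideal.pow_right_mono h1 N h2
  rw [hN] at h3
  simpa using h3

theorem artAlg_isArtinian (A : ArtAlg Λ) : IsArtinian Λ A.carrier := by
  have h := IsLocalRing.length_restrictScalars Λ A.carrier A.carrier
  have h1 : Module.length A.carrier A.carrier ≠ ⊤ :=
    Module.length_ne_top_iff.mpr (isFiniteLength_iff_isNoetherian_isArtinian.mpr ⟨inferInstance, A.art⟩)
  have h2 : Module.length (ResidueField Λ) (ResidueField A.carrier) ≠ ⊤ := by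
    have : Module.Finite (ResidueField Λ) (ResidueField A.carrier) := by
      refine Module.Finite.of_surjective (Algebra.linearMap _ _) ?_
      intro a
      obtain ⟨a, rfl⟩ := residue_surjective a
      obtain ⟨c, hc⟩ := A.resSurj a
      refine ⟨residue Λ c, ?_⟩
      have : residue A.carrier (a - algebraMap Λ A.carrier c) = 0 :=
        (residue_eq_zero_iff _).mpr hc
      rw [map_sub, sub_eq_zero] at this
      rw [this]
      rfl
    rw [Module.length_eq_finrank]
    exact ENat.natCast_ne_top _
  have h3 : Module.length Λ A.carrier ≠ ⊤ := by
    rw [h]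
    exact WithTop.mul_ne_top h1 h2
  rw [Module.length_ne_top_iff, isFiniteLength_iff_isNoetherian_isArtinian] at h3
  exact h3.2

theorem subalg_isUnit {A : ArtAlg Λ} (S : Subalgebra Λ A.carrier) (a : S)
    (ha : IsUnit (a : A.carrier)) : IsUnit a := by
  obtain ⟨c, hc⟩ := A.resSurj a
  have hcu : IsUnit c := by
    refine A.locHom.1 c ?_
    by_contra hcn
    have h1 : algebraMap Λ A.carrier c ∈ maximalIdeal A.carrier := (mem_maximalIdeal _).mpr hcn
    have h2 := Ideal.add_mem _ hc h1
    rw [sub_add_cancel] at h2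
    exact (mem_maximalIdeal _).mp h2 ha
  obtain ⟨N, hN⟩ := (isArtinianRing_iff_isNilpotent_maximalIdeal A.carrier).mp A.art
  have hnil : IsNilpotent (a - algebraMap Λ S c) := by
    refine ⟨N, Subtype.ext ?_⟩
    have := Ideal.pow_mem_pow hc N
    rw [hN] at this
    simpa using this
  have := hnil.isUnit_add_left_of_commute (hcu.map (algebraMap Λ S)) (Commute.all _ _)
  simpa using this

/-- A `Λ`-subalgebra of `A` as an object of `Art`. -/
abbrev subArt (A : ArtAlg Λ) (S : Subalgebra Λ A.carrier) : ArtAlg Λ :=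
  haveI hv : IsLocalHom (S.val.toRingHom) := ⟨fun a ha => subalg_isUnit S a ha⟩
  haveI hl : IsLocalRing S := RingHom.domain_isLocalRing S.val.toRingHom
  { carrier := S
    loc := hl
    art := by
      have := artAlg_isArtinian A
      have h : IsArtinian Λ S := isArtinian_of_injective S.val.toLinearMap Subtype.val_injective
      exact isArtinian_of_tower Λ h
    locHom := ⟨fun c hc => A.locHom.1 c (hc.map S.val.toRingHom)⟩
    resSurj := by
      intro a
      obtain ⟨c, hc⟩ := A.resSurj a
      refine ⟨c, ?_⟩
      rw [mem_maximalIdeal] at hc ⊢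
      exact fun h => hc (h.map S.val.toRingHom) }

/-- The inclusion of a subalgebra. -/
def subIncl (A : ArtAlg Λ) (S : Subalgebra Λ A.carrier) : ArtHom (subArt A S) A :=
  ⟨S.val, ⟨fun a ha => subalg_isUnit S a ha⟩⟩

/-- Inclusions between subalgebras. -/
def subInclusion (A : ArtAlg Λ) {S T : Subalgebra Λ A.carrier} (h : S ≤ T) :
    ArtHom (subArt A S) (subArt A T) :=
  ⟨Subalgebra.inclusion h, ⟨fun a ha => subalg_isUnit S a (ha.map T.val.toRingHom)⟩⟩

/-! ### The truncations `F_n = F/m^(n+1)` -/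

/-- `F_n = F/m^(n+1)`. -/
abbrev trunc (F : ProRepAlg Λ) (n : ℕ) : ArtAlg Λ :=
  quotArt F (maximalIdeal F.carrier ^ (n + 1)) (Ideal.pow_le_self (Nat.succ_ne_zero n))
    ⟨n + 1, le_rfl⟩

/-- `F → F_n`. -/
abbrev truncProj (F : ProRepAlg Λ) (n : ℕ) : (hFunctor F).obj (trunc F n) :=
  quotProj F (maximalIdeal F.carrier ^ (n + 1)) (Ideal.pow_le_self (Nat.succ_ne_zero n))
    ⟨n + 1, le_rfl⟩

theorem exists_trans (F : ProRepAlg Λ) (n : ℕ) :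
    ∃ t : ArtHom (trunc F (n + 1)) (trunc F n),
      (hFunctor F).map t (truncProj F (n + 1)) = truncProj F n ∧
      ∀ a, t.toAlgHom (Ideal.Quotient.mk _ a) = Ideal.Quotient.mk _ a := by
  refine exists_factor F _ _ _ (truncProj F n) ?_
  intro a ha
  exact Ideal.Quotient.eq_zero_iff_mem.mpr (Ideal.pow_le_pow_right (by omega) ha)

theorem exists_trunc_factor (F : ProRepAlg Λ) {A : ArtAlg Λ} (x : (hFunctor F).obj A) (M : ℕ) :
    ∃ n, M ≤ n ∧ ∃ f : ArtHom (trunc F n) A, (hFunctor F).map f (truncProj F n) = x ∧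
      ∀ a, f.toAlgHom (Ideal.Quotient.mk _ a) = x.1 a := by
  obtain ⟨N, hN⟩ := kills_pow F x
  exact ⟨max M N, le_max_left _ _,
    exists_factor F _ _ _ x (hN _ (le_trans (le_max_right M N) (Nat.le_succ _)))⟩

theorem precompEnd_map {F : ProRepAlg Λ} {A B : ArtAlg Λ} (g : LocHom Λ F.carrier F.carrier)
    (f : ArtHom A B) (z : (hFunctor F).obj A) :
    precompEnd g ((hFunctor F).map f z) = (hFunctor F).map f (precompEnd g z) := rfl

/-- Successive lifting. -/
theorem exists_limit {F : ProRepAlg Λ} {𝓓 : ArtFunctor Λ} (α : ArtNatTrans (hFunctor F) 𝓓)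
    (hα : FormallySmooth' α) (N : ℕ) (u : (hFunctor F).obj (trunc F N))
    (hu : α.app _ u = α.app _ (truncProj F N)) :
    ∃ g : LocHom Λ F.carrier F.carrier, precompEnd g (truncProj F N) = u ∧
      ∀ n, N ≤ n → α.app _ (precompEnd g (truncProj F n)) = α.app _ (truncProj F n) := by
  have step : ∀ (i : ℕ) (v : {v : (hFunctor F).obj (trunc F (N + i)) //
        α.app _ v = α.app _ (truncProj F (N + i))}),
      ∃ w : {w : (hFunctor F).obj (trunc F (N + (i + 1))) //
        α.app _ w = α.app _ (truncProj F (N + (i + 1)))},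
        ∀ a, Ideal.Quotient.factorPow (maximalIdeal F.carrier) (Nat.le_succ (N + i + 1))
          (w.1.1 a) = v.1.1 a := by
    intro i v
    obtain ⟨t, ht, ht'⟩ := exists_trans F (N + i)
    have hts : Function.Surjective t.toAlgHom := by
      intro b
      obtain ⟨b, rfl⟩ := Ideal.Quotient.mk_surjective b
      exact ⟨_, ht' b⟩
    obtain ⟨w, hw, hw'⟩ := hα t hts v.1 (α.app _ (truncProj F (N + i + 1)))
      (by rw [v.2, ← α.naturality, ht])
    refine ⟨⟨w, hw'⟩, fun a => ?_⟩
    rw [← hw]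
    change _ = t.toAlgHom (w.1 a)
    obtain ⟨b, hb⟩ := Ideal.Quotient.mk_surjective (w.1 a)
    rw [← hb, ht']
    rfl
  choose nxt hnxt using step
  let seq : ∀ i : ℕ, {v : (hFunctor F).obj (trunc F (N + i)) //
        α.app _ v = α.app _ (truncProj F (N + i))} :=
    fun i => Nat.rec ⟨u, hu⟩ (fun i v => nxt i v) i
  have ha : StrictMono (fun i : ℕ => N + i + 1) := fun i j h => by
    simp only []
    omega
  let f : (i : ℕ) → F.carrier →+* F.carrier ⧸ maximalIdeal F.carrier ^ ((fun i : ℕ => N + i + 1) i) :=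
    fun i => (seq i).1.1.toRingHom
  have hf : ∀ {m}, (Ideal.Quotient.factorPow (maximalIdeal F.carrier)
      (ha.monotone m.le_succ)).comp (f (m + 1)) = f m := by
    intro m
    ext a
    exact hnxt m (seq m) a
  let g0 := IsAdicComplete.StrictMono.liftRingHom (maximalIdeal F.carrier) ha f hf
  have hg0 : ∀ i a, (Ideal.Quotient.mk (maximalIdeal F.carrier ^ (N + i + 1))) (g0 a) =
      (seq i).1.1 a := fun i a =>
    IsAdicComplete.StrictMono.mk_liftRingHom (I := maximalIdeal F.carrier) ha f hf (n := i) a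
  let g1 : F.carrier →ₐ[Λ] F.carrier :=
    { g0 with
      commutes' := by
        intro c
        change g0 _ = _
        refine congrFun (IsHausdorff.StrictMono.funext' (maximalIdeal F.carrier) ha
          (f := fun _ : Unit => g0 (algebraMap Λ F.carrier c))
          (g := fun _ : Unit => algebraMap Λ F.carrier c) ?_) ()
        intro i _
        refine (hg0 i _).trans ?_
        rw [AlgHom.commutes]
        rfl }
  have hg1 : ∀ i a, (Ideal.Quotient.mk (maximalIdeal F.carrier ^ (N + i + 1))) (g1 a) =
      (seq i).1.1 a := hg0
  have hloc : IsLocalHom g1.toRingHom := by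
    refine ⟨fun a h => ?_⟩
    refine (seq 0).1.2.1 a ?_
    change IsUnit ((seq 0).1.1 a)
    rw [← hg1 0 a]
    exact h.map _
  refine ⟨⟨g1, hloc⟩, ?_, ?_⟩
  · exact Subtype.ext (AlgHom.ext fun a => hg1 0 a)
  · intro n hn
    obtain ⟨i, rfl⟩ := Nat.exists_eq_add_of_le hn
    have : precompEnd ⟨g1, hloc⟩ (truncProj F (N + i)) = (seq i).1 :=
      Subtype.ext (AlgHom.ext fun a => hg1 i a)
    rw [this]
    exact (seq i).2

theorem limit_invariant {F : ProRepAlg Λ} {𝓓 : ArtFunctor Λ} (α : ArtNatTrans (hFunctor F) 𝓓)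
    (N : ℕ) (g : LocHom Λ F.carrier F.carrier)
    (hg : ∀ n, N ≤ n → α.app _ (precompEnd g (truncProj F n)) = α.app _ (truncProj F n))
    {A : ArtAlg Λ} (z : (hFunctor F).obj A) : α.app A (precompEnd g z) = α.app A z := by
  obtain ⟨n, hn, f, hf, -⟩ := exists_trunc_factor F z N
  rw [← hf, precompEnd_map, α.naturality, α.naturality, hg n hn]

/-! ### Endomorphisms trivial on the tangent space are automorphisms -/

theorem map_algebraMap_le (F : ProRepAlg Λ) :
    (maximalIdeal Λ).map (algebraMap Λ F.carrier) ≤ maximalIdeal F.carrier := by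
  rw [Ideal.map_le_iff_le_comap]
  exact fun y hy => map_mem_maximalIdeal _ F.locHom hy

theorem end_map_eq {F : ProRepAlg Λ} (g : LocHom Λ F.carrier F.carrier)
    (hg : ∀ x ∈ maximalIdeal F.carrier, g.1 x - x ∈ maximalIdeal F.carrier ^ 2 ⊔
      Ideal.map (algebraMap Λ F.carrier) (maximalIdeal Λ)) :
    (maximalIdeal F.carrier).map g.1.toRingHom = maximalIdeal F.carrier := by
  apply le_antisymm
  · rw [Ideal.map_le_iff_le_comap]
    exact fun y hy => map_mem_maximalIdeal _ g.2 hy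
  · refine Submodule.le_of_le_smul_of_le_jacobson_bot (I := maximalIdeal F.carrier)
      (IsNoetherian.noetherian _) (IsLocalRing.maximalIdeal_le_jacobson _) ?_
    intro x hx
    have h1 : g.1 x ∈ (maximalIdeal F.carrier).map g.1.toRingHom :=
      Ideal.mem_map_of_mem g.1.toRingHom hx
    have h2 : Ideal.map (algebraMap Λ F.carrier) (maximalIdeal Λ) ≤
        (maximalIdeal F.carrier).map g.1.toRingHom := by
      rw [Ideal.map_le_iff_le_comap]
      intro c hc
      have := Ideal.mem_map_of_mem g.1.toRingHom
        (map_algebraMap_le F (Ideal.mem_map_of_mem (algebraMap Λ F.carrier) hc))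
      change g.1 (algebraMap Λ F.carrier c) ∈ _ at this
      rw [AlgHom.commutes] at this
      exact this
    have h3 : maximalIdeal F.carrier ^ 2 ⊔ Ideal.map (algebraMap Λ F.carrier) (maximalIdeal Λ) ≤
        (maximalIdeal F.carrier).map g.1.toRingHom ⊔
          maximalIdeal F.carrier • maximalIdeal F.carrier := by
      refine sup_le ?_ (h2.trans le_sup_left)
      rw [pow_two]
      exact le_sup_right
    have h4 := Ideal.sub_mem _ (Ideal.mem_sup_left h1) (h3 (hg x hx))
    rwa [sub_sub_cancel] at h4

theorem end_bijective {F : ProRepAlg Λ} (g : LocHom Λ F.carrier F.carrier)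
    (hg : ∀ x ∈ maximalIdeal F.carrier, g.1 x - x ∈ maximalIdeal F.carrier ^ 2 ⊔
      Ideal.map (algebraMap Λ F.carrier) (maximalIdeal Λ)) : Function.Bijective g.1 := by
  have hs : Function.Surjective g.1.toRingHom := by
    have hm := end_map_eq g hg
    have : IsHausdorff ((maximalIdeal F.carrier).map g.1.toRingHom) F.carrier := by
      rw [hm]
      infer_instance
    refine surjective_of_mk_map_comp_surjective (I := maximalIdeal F.carrier) g.1.toRingHom ?_
    intro b
    obtain ⟨b, rfl⟩ := Ideal.Quotient.mk_surjective b
    obtain ⟨c, hc⟩ := F.resSurj b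
    refine ⟨algebraMap Λ F.carrier c, ?_⟩
    change Ideal.Quotient.mk _ (g.1 (algebraMap Λ F.carrier c)) = _
    rw [AlgHom.commutes, eq_comm, Ideal.Quotient.eq, hm]
    exact hc
  refine ⟨?_, hs⟩
  have hs' : ∀ n : ℕ, Function.Surjective ⇑(g.1.toRingHom ^ n : F.carrier →+* F.carrier) := by
    intro n
    rw [RingHom.coe_pow]
    exact hs.iterate n
  let chain : ℕ →o Ideal F.carrier :=
    { toFun := fun n => RingHom.ker (g.1.toRingHom ^ n)
      monotone' := by
        refine monotone_nat_of_le_succ fun n a ha => ?_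
        rw [RingHom.mem_ker] at ha ⊢
        rw [pow_succ']
        change g.1.toRingHom ((g.1.toRingHom ^ n) a) = 0
        rw [ha, map_zero] }
  obtain ⟨n, hn⟩ := monotone_stabilizes_iff_noetherian.mpr F.noeth chain
  change Function.Injective g.1.toRingHom
  rw [injective_iff_map_eq_zero]
  intro a ha
  obtain ⟨b, rfl⟩ := hs' n a
  have h1 : b ∈ chain (n + 1) := by
    change b ∈ RingHom.ker (g.1.toRingHom ^ (n + 1))
    rw [RingHom.mem_ker, pow_succ']
    exact ha
  rw [← hn (n + 1) (Nat.le_succ n)] at h1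
  exact h1

/-! ### The rings `k` and `k[TF*]` -/

theorem isKV_quot (F : ProRepAlg Λ) (I : Ideal F.carrier) (hI : I ≤ maximalIdeal F.carrier)
    (hn : ∃ n : ℕ, maximalIdeal F.carrier ^ n ≤ I)
    (h : maximalIdeal F.carrier ^ 2 ⊔ Ideal.map (algebraMap Λ F.carrier) (maximalIdeal Λ) ≤ I) :
    IsKV (quotArt F I hI hn) := by
  have hl : IsLocalRing (F.carrier ⧸ I) := quot_isLocalRing I hI
  constructor
  · change maximalIdeal (F.carrier ⧸ I) ^ 2 = ⊥
    rw [quot_maximalIdeal, ← Ideal.map_pow, eq_bot_iff, Ideal.map_le_iff_le_comap]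
    intro x hx
    rw [Ideal.mem_comap, Ideal.mem_bot, Ideal.Quotient.eq_zero_iff_mem]
    exact h (Ideal.mem_sup_left hx)
  · rw [eq_bot_iff, Ideal.map_le_iff_le_comap]
    intro c hc
    rw [Ideal.mem_comap, Ideal.mem_bot]
    change Ideal.Quotient.mk I (algebraMap Λ F.carrier c) = 0
    rw [Ideal.Quotient.eq_zero_iff_mem]
    exact h (Ideal.mem_sup_right (Ideal.mem_map_of_mem _ hc))

theorem tangent_le (F : ProRepAlg Λ) : maximalIdeal F.carrier ^ 2 ⊔
    Ideal.map (algebraMap Λ F.carrier) (maximalIdeal Λ) ≤ maximalIdeal F.carrier :=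
  sup_le (Ideal.pow_le_self two_ne_zero) (map_algebraMap_le F)

theorem tangent_trivial {F : ProRepAlg Λ} {𝓓 : ArtFunctor Λ} (α : ArtNatTrans (hFunctor F) 𝓓)
    (hα : ∀ A : ArtAlg Λ, IsKV A → Function.Bijective (α.app A))
    (g : LocHom Λ F.carrier F.carrier)
    (hg : ∀ (A : ArtAlg Λ) (z : (hFunctor F).obj A), α.app A (precompEnd g z) = α.app A z)
    (x : F.carrier) : g.1 x - x ∈ maximalIdeal F.carrier ^ 2 ⊔
      Ideal.map (algebraMap Λ F.carrier) (maximalIdeal Λ) := by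
  have h1 := (hα _ (isKV_quot F _ (tangent_le F) ⟨2, le_sup_left⟩ le_rfl)).1 (hg _ (quotProj F _
    (tangent_le F) ⟨2, le_sup_left⟩))
  have h2 := DFunLike.congr_fun (congrArg Subtype.val h1) x
  exact Ideal.Quotient.eq.mp h2

/-- The residue field, as a quotient of `A`. -/
def resArt (A : ArtAlg Λ) : ArtAlg Λ :=
  haveI hl : IsLocalRing (A.carrier ⧸ maximalIdeal A.carrier) := quot_isLocalRing _ le_rfl
  { carrier := A.carrier ⧸ maximalIdeal A.carrier
    loc := hl
    locHom := by
      have := IsLocalHom.of_surjective (Ideal.Quotient.mk (maximalIdeal A.carrier))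
        Ideal.Quotient.mk_surjective
      exact ⟨fun a h => A.locHom.1 a (this.1 _ h)⟩
    resSurj := by
      intro a
      obtain ⟨a, rfl⟩ := Ideal.Quotient.mk_surjective a
      obtain ⟨c, hc⟩ := A.resSurj a
      refine ⟨c, ?_⟩
      rw [quot_maximalIdeal]
      exact Ideal.mem_map_of_mem (Ideal.Quotient.mk _) hc }

/-- The projection to the residue field. -/
def resProj (A : ArtAlg Λ) : ArtHom A (resArt A) := ⟨Ideal.Quotient.mkₐ Λ (maximalIdeal A.carrier), by
    have hl : IsLocalRing (A.carrier ⧸ maximalIdeal A.carrier) := quot_isLocalRing _ le_rfl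
    exact IsLocalHom.of_surjective (Ideal.Quotient.mk (maximalIdeal A.carrier))
      Ideal.Quotient.mk_surjective⟩

theorem isKV_resArt (A : ArtAlg Λ) : IsKV (resArt A) := by
  have hm : maximalIdeal (resArt A).carrier = ⊥ := by
    have hl : IsLocalRing (A.carrier ⧸ maximalIdeal A.carrier) := quot_isLocalRing _ le_rfl
    refine (quot_maximalIdeal (maximalIdeal A.carrier)).trans ?_
    exact Ideal.map_quotient_self _
  constructor
  · rw [hm, pow_two, Ideal.bot_mul]
  · rw [eq_bot_iff, ← hm, Ideal.map_le_iff_le_comap]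
    exact fun y hy => map_mem_maximalIdeal _ (resArt A).locHom hy

theorem hull_surjective {F : ProRepAlg Λ} {𝓓 : ArtFunctor Λ} (α : ArtNatTrans (hFunctor F) 𝓓)
    (hs : FormallySmooth' α) (hα : ∀ A : ArtAlg Λ, IsKV A → Function.Bijective (α.app A))
    (A : ArtAlg Λ) : Function.Surjective (α.app A) := by
  intro d
  obtain ⟨b, hb⟩ := (hα _ (isKV_resArt A)).2 (𝓓.map (resProj A) d)
  obtain ⟨a, -, ha⟩ := hs (resProj A) Ideal.Quotient.mk_surjective b d hb
  exact ⟨a, ha⟩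

/-! ### From a hull to a quotient -/

/-- The group of automorphisms of `F` compatible with `α`. -/
def hullGroup {F : ProRepAlg Λ} {𝓓 : ArtFunctor Λ} (α : ArtNatTrans (hFunctor F) 𝓓) :
    Subgroup (F.carrier ≃ₐ[Λ] F.carrier) where
  carrier := {g | ∀ (A : ArtAlg Λ) (z : (hFunctor F).obj A),
    α.app A (precompAut g z) = α.app A z}
  one_mem' A z := rfl
  mul_mem' {g h} hg hh A z := (hh A (precompAut g z)).trans (hg A z)
  inv_mem' {g} hg A z := by
    have h1 : precompAut g (precompAut g⁻¹ z) = z := Subtype.ext (AlgHom.ext fun a =>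
      show z.1 (g.symm (g a)) = z.1 a by rw [g.symm_apply_apply])
    have h2 := hg A (precompAut g⁻¹ z)
    rw [h1] at h2
    exact h2.symm

theorem exists_aut_of_surjective {F : ProRepAlg Λ} {𝓓 : ArtFunctor Λ}
    (α : ArtNatTrans (hFunctor F) 𝓓)
    (hs : FormallySmooth' α) (hα : ∀ A : ArtAlg Λ, IsKV A → Function.Bijective (α.app A))
    {A : ArtAlg Λ} (x y : (hFunctor F).obj A) (hx : Function.Surjective x.1)
    (hxy : α.app A x = α.app A y) : ∃ g ∈ hullGroup α, precompAut g x = y := by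
  obtain ⟨N, -, f, hf, hf'⟩ := exists_trunc_factor F x 0
  have hfs : Function.Surjective f.toAlgHom := by
    intro a
    obtain ⟨b, rfl⟩ := hx a
    exact ⟨_, hf' b⟩
  obtain ⟨u, hu, hu'⟩ := hs f hfs y (α.app _ (truncProj F N))
    (by rw [← hxy, ← α.naturality, hf])
  obtain ⟨g, hg, hg'⟩ := exists_limit α hs N u hu'
  have hinv : ∀ (A : ArtAlg Λ) (z : (hFunctor F).obj A),
      α.app A (precompEnd g z) = α.app A z := fun A z => limit_invariant α N g hg' z
  have hb := end_bijective g (fun x _ => tangent_trivial α hα g hinv x)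
  refine ⟨AlgEquiv.ofBijective g.1 hb, fun A z => ?_, ?_⟩
  · exact hinv A z
  · have h1 : precompEnd g x = y := by
      rw [← hf, precompEnd_map, hg, hu]
    exact h1

theorem exists_aut {F : ProRepAlg Λ} {𝓓 : ArtFunctor Λ}
    (α : ArtNatTrans (hFunctor F) 𝓓)
    (hs : FormallySmooth' α) (hα : ∀ A : ArtAlg Λ, IsKV A → Function.Bijective (α.app A))
    (hfib : ∀ {A B C R : ArtAlg Λ} (f : ArtHom A B) (g : ArtHom C B)
      (p : ArtHom R A) (q : ArtHom R C), IsFibreProduct f g p q →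
      ∀ (dA : (𝓓).obj A) (dC : (𝓓).obj C),
        (𝓓).map f dA = (𝓓).map g dC →
        ∃ dR : (𝓓).obj R, (𝓓).map p dR = dA ∧ (𝓓).map q dR = dC)
    {A : ArtAlg Λ} (x y : (hFunctor F).obj A)
    (hxy : α.app A x = α.app A y) : ∃ g ∈ hullGroup α, precompAut g x = y := by
  have hr : ∀ z : (hFunctor F).obj A, ∃ z' : (hFunctor F).obj (subArt A z.1.range),
      Function.Surjective z'.1 ∧ (hFunctor F).map (subIncl A z.1.range) z' = z := by
    intro z
    refine ⟨⟨z.1.rangeRestrict, ⟨fun a h => z.2.1 a (h.map (z.1.range).val.toRingHom)⟩⟩,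
      z.1.rangeRestrict_surjective, Subtype.ext (AlgHom.ext fun a => rfl)⟩
  obtain ⟨x', hx', hxx⟩ := hr x
  obtain ⟨y', hy', hyy⟩ := hr y
  let p := subInclusion A (inf_le_left : x.1.range ⊓ y.1.range ≤ x.1.range)
  let q := subInclusion A (inf_le_right : x.1.range ⊓ y.1.range ≤ y.1.range)
  have hpq : IsFibreProduct (subIncl A x.1.range) (subIncl A y.1.range) p q := by
    refine ⟨fun r => rfl, ?_⟩
    rintro ⟨a, ha⟩ ⟨c, hc⟩ hac
    obtain rfl : a = c := hac
    refine ⟨⟨a, ha, hc⟩, ⟨rfl, rfl⟩, ?_⟩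
    rintro ⟨r, hr⟩ ⟨h1, -⟩
    have h2 : r = a := congrArg Subtype.val h1
    exact Subtype.ext h2
  obtain ⟨d, hd1, hd2⟩ := hfib _ _ p q hpq (α.app _ x') (α.app _ y')
    (by rw [← α.naturality, ← α.naturality, hxx, hyy, hxy])
  obtain ⟨z, rfl⟩ := hull_surjective α hs hα _ d
  rw [← α.naturality] at hd1 hd2
  obtain ⟨g, hg, hgx⟩ := exists_aut_of_surjective α hs hα x' _ hx' hd1.symm
  obtain ⟨h, hh, hhy⟩ := exists_aut_of_surjective α hs hα y' _ hy' hd2.symm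
  have e : precompAut g x = precompAut h y := by
    have e1 : precompAut g x = (hFunctor F).map (subIncl A _) ((hFunctor F).map p z) := by
      rw [← hgx]
      conv_lhs => rw [← hxx]
      rfl
    have e2 : precompAut h y = (hFunctor F).map (subIncl A _) ((hFunctor F).map q z) := by
      rw [← hhy]
      conv_lhs => rw [← hyy]
      rfl
    rw [e1, e2]
    rfl
  refine ⟨g * h⁻¹, mul_mem hg (inv_mem hh), ?_⟩
  have e3 : precompAut (g * h⁻¹) x = precompAut h⁻¹ (precompAut g x) := rfl
  rw [e3, e]
  exact Subtype.ext (AlgHom.ext fun a =>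
      show y.1 (h (h.symm a)) = y.1 a by rw [h.apply_symm_apply])

/-! ### From a quotient to a hull -/

theorem trivial_on_KV {F : ProRepAlg Λ} (g : F.carrier ≃ₐ[Λ] F.carrier)
    (hg : ActsTriviallyOnTangent F g) {A : ArtAlg Λ} (hA : IsKV A) (x : (hFunctor F).obj A) :
    precompAut g x = x := by
  refine Subtype.ext (AlgHom.ext fun a => ?_)
  change x.1 (g a) = x.1 a
  have hker : maximalIdeal F.carrier ^ 2 ⊔
      Ideal.map (algebraMap Λ F.carrier) (maximalIdeal Λ) ≤ RingHom.ker x.1.toRingHom := by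
    refine sup_le ?_ ?_
    · have h1 : (maximalIdeal F.carrier).map x.1.toRingHom ≤ maximalIdeal A.carrier := by
        rw [Ideal.map_le_iff_le_comap]
        exact fun y hy => map_mem_maximalIdeal _ x.2 hy
      have h2 := Ideal.pow_right_mono h1 2
      rw [hA.1, ← Ideal.map_pow, Ideal.map_le_iff_le_comap] at h2
      exact h2
    · rw [Ideal.map_le_iff_le_comap]
      intro c hc
      have h1 := Ideal.mem_map_of_mem (algebraMap Λ A.carrier) hc
      rw [hA.2, Ideal.mem_bot] at h1
      change x.1 (algebraMap Λ F.carrier c) = 0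
      rw [AlgHom.commutes, h1]
  obtain ⟨c, hc⟩ := F.resSurj a
  have h := hker (hg _ hc)
  rw [map_sub, AlgEquiv.commutes, sub_sub_sub_cancel_right] at h
  have h' : x.1 (g a - a) = 0 := h
  rwa [map_sub, sub_eq_zero] at h'

theorem quot_smooth (F : ProRepAlg Λ) (Γ : Subgroup (F.carrier ≃ₐ[Λ] F.carrier)) :
    FormallySmooth' (quotMap F Γ) := by
  intro A B π _ b d hbd
  obtain ⟨a, rfl⟩ := Quotient.exists_rep d
  obtain ⟨g, hg, h⟩ := Quotient.exact hbd.symm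
  refine ⟨precompAut g a, h, Eq.symm (Quotient.sound ?_)⟩
  exact ⟨g, hg, rfl⟩

theorem h_fibre (F : ProRepAlg Λ) {A B C R : ArtAlg Λ} (f : ArtHom A B) (g : ArtHom C B)
    (p : ArtHom R A) (q : ArtHom R C) (h : IsFibreProduct f g p q)
    (a : (hFunctor F).obj A) (c : (hFunctor F).obj C)
    (hac : (hFunctor F).map f a = (hFunctor F).map g c) :
    ∃ r : (hFunctor F).obj R, (hFunctor F).map p r = a ∧ (hFunctor F).map q r = c := by
  have hac' : ∀ t, f.toAlgHom (a.1 t) = g.toAlgHom (c.1 t) := fun t =>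
    DFunLike.congr_fun (congrArg Subtype.val hac) t
  have hex := fun t => (h.2 _ _ (hac' t)).exists
  choose r hp hq using hex
  have huniq : ∀ r r' : R.carrier, p.toAlgHom r = p.toAlgHom r' →
      q.toAlgHom r = q.toAlgHom r' → r = r' := fun r r' h1 h2 =>
    (h.2 _ _ (h.1 r')).unique ⟨h1, h2⟩ ⟨rfl, rfl⟩
  let r' : F.carrier →ₐ[Λ] R.carrier :=
    { toFun := r
      map_one' := huniq _ _ (by simp [hp]) (by simp [hq])
      map_mul' := fun s t => huniq _ _ (by simp [hp]) (by simp [hq])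
      map_zero' := huniq _ _ (by simp [hp]) (by simp [hq])
      map_add' := fun s t => huniq _ _ (by simp [hp]) (by simp [hq])
      commutes' := fun s => huniq _ _ (by simp [hp]) (by simp [hq]) }
  refine ⟨⟨r', ⟨fun t ht => a.2.1 t ?_⟩⟩, ?_, ?_⟩
  · have := ht.map p.toAlgHom
    change IsUnit (p.toAlgHom (r t)) at this
    rw [hp] at this
    exact this
  · exact Subtype.ext (AlgHom.ext fun t => hp t)
  · exact Subtype.ext (AlgHom.ext fun t => hq t)

theorem quot_fibre (F : ProRepAlg Λ) (Γ : Subgroup (F.carrier ≃ₐ[Λ] F.carrier))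
    {A B C R : ArtAlg Λ} (f : ArtHom A B) (g : ArtHom C B)
    (p : ArtHom R A) (q : ArtHom R C) (h : IsFibreProduct f g p q)
    (a : (quotFunctor F Γ).obj A) (c : (quotFunctor F Γ).obj C)
    (hac : (quotFunctor F Γ).map f a = (quotFunctor F Γ).map g c) :
    ∃ r : (quotFunctor F Γ).obj R,
      (quotFunctor F Γ).map p r = a ∧ (quotFunctor F Γ).map q r = c := by
  obtain ⟨a, rfl⟩ := Quotient.exists_rep a
  obtain ⟨c, rfl⟩ := Quotient.exists_rep c
  obtain ⟨γ, hγ, e⟩ := Quotient.exact hac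
  obtain ⟨r, h1, h2⟩ := h_fibre F f g p q h (precompAut γ a) c e
  refine ⟨(quotMap F Γ).app R r, ?_, ?_⟩
  · rw [← (quotMap F Γ).naturality, h1]
    refine Eq.symm (Quotient.sound ?_)
    exact ⟨γ, hγ, rfl⟩
  · rw [← (quotMap F Γ).naturality, h2]
    rfl

/-- Main theorem. `𝓓` is isomorphic to a quotient `h_F/Γ` with
`Γ ⊆ Aut^T_Λ(F)` if and only if `𝓓` has a hull and
`𝓓(A ×_B C) → 𝓓(A) ×_{𝓓(B)} 𝓓(C)` is surjective for all `A → B ← C`. -/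
theorem main_theorem {Λ : Type u} [CommRing Λ] [IsLocalRing Λ] [IsNoetherianRing Λ]
    [IsAdicComplete (maximalIdeal Λ) Λ] (𝓓 : ArtFunctor Λ) :
    (∃ (F : ProRepAlg Λ) (Γ : Subgroup (F.carrier ≃ₐ[Λ] F.carrier)),
        (∀ g ∈ Γ, ActsTriviallyOnTangent F g) ∧
        ∃ η : ArtNatTrans (quotFunctor F Γ) 𝓓,
          ∀ A : ArtAlg Λ, Function.Bijective (η.app A)) ↔
      (HasHull 𝓓 ∧
        ∀ {A B C R : ArtAlg Λ} (f : ArtHom A B) (g : ArtHom C B)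
      (p : ArtHom R A) (q : ArtHom R C), IsFibreProduct f g p q →
      ∀ (dA : (𝓓).obj A) (dC : (𝓓).obj C),
        (𝓓).map f dA = (𝓓).map g dC →
        ∃ dR : (𝓓).obj R, (𝓓).map p dR = dA ∧ (𝓓).map q dR = dC) := by
  constructor
  · rintro ⟨F, Γ, hΓ, η, hη⟩
    refine ⟨⟨F, ⟨fun A x => η.app A ((quotMap F Γ).app A x), fun f x => ?_⟩, ?_, ?_⟩, ?_⟩
    · rw [(quotMap F Γ).naturality, η.naturality]
    · intro A B π hπ b d hbd
      obtain ⟨d, rfl⟩ := (hη A).2 d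
      obtain ⟨a, h1, h2⟩ := quot_smooth F Γ π hπ b d
        ((hη B).1 (hbd.trans (η.naturality π d).symm))
      exact ⟨a, h1, congrArg (η.app A) h2⟩
    · intro A hA
      refine (hη A).comp ⟨fun x y hxy => ?_, Quotient.exists_rep⟩
      obtain ⟨g, hg, e⟩ := Quotient.exact hxy
      rw [← e, trivial_on_KV g (hΓ g hg) hA]
    · intro A B C R f g p q h dA dC hd
      obtain ⟨a, rfl⟩ := (hη A).2 dA
      obtain ⟨c, rfl⟩ := (hη C).2 dC
      rw [← η.naturality, ← η.naturality] at hd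
      obtain ⟨r, h1, h2⟩ := quot_fibre F Γ f g p q h a c ((hη B).1 hd)
      exact ⟨η.app R r, by rw [← η.naturality, h1], by rw [← η.naturality, h2]⟩
  · rintro ⟨⟨F, α, hs, hα⟩, hfib⟩
    refine ⟨F, hullGroup α, ?_, ⟨fun A => Quotient.lift (α.app A) ?_, ?_⟩, ?_⟩
    · intro g hg x _
      exact tangent_trivial α hα ⟨g.toAlgHom, AlgEquiv.isLocalHom_toRingHom g⟩ hg x
    · rintro x y ⟨g, hg, rfl⟩
      exact (hg A x).symm
    · intro A B f x
      obtain ⟨x, rfl⟩ := Quotient.exists_rep x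
      exact α.naturality f x
    · intro A
      constructor
      · intro x y hxy
        obtain ⟨x, rfl⟩ := Quotient.exists_rep x
        obtain ⟨y, rfl⟩ := Quotient.exists_rep y
        exact Quotient.sound (exists_aut α hs hα hfib x y hxy)
      · intro d
        obtain ⟨x, rfl⟩ := hull_surjective α hs hα A d
        exact ⟨Quotient.mk _ x, rfl⟩
end
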